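/- arXiv:1212.5105 — 2 statements merged into one kernel-verified Lean document; each statement's English description precedes it below -/
import Mathlib

section
/- Let $k$ be an algebraically closed field, and let $V\subseteq\mathbb P^n$ and $W\subseteq\mathbb P^m$ be two positive dimensional normal complete intersection varieties over $k$; that is, $V$ and $W$ are integral normal closed subschemes whose homogeneous ideals are generated by regular sequences of forms. Embed $V\times W$ in $\mathbb P^N$, $N+1=(n+1)(m+1)$, by the Segre embedding of $\mathbb P^n\times\mathbb P^m$. Let $p\in V$ be a closed point, and let $H\subset W$ be a closed subscheme such that $\{p\}\times H$ is a hyperplane section of $\{p\}\times W$ in $\mathbb P^N$, i.e. the scheme-theoretic intersection of $\{p\}\times W$ with a hyperplane of $\mathbb P^N$ that does not contain it. Let $Y=C(V\times W)\subset\mathbb A^{N+1}$ and $Z=C(V\times H)\subset Y$ be the affine cones, that is, the spectra of the homogeneous coordinate rings. Then the blow-up $X$ of $Y$ along $Z$ is Gorenstein. -/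
open AlgebraicGeometry CategoryTheory

universe u

/-! ### Gorenstein and normal schemes -/

/-- A ring is a *Gorenstein local ring* if it is local, Noetherian, and of finite injective
dimension as a module over itself. -/
structure IsGorensteinLocalRing (R : Type u) [CommRing R] : Prop where
  isLocalRing : IsLocalRing R
  isNoetherianRing : IsNoetherianRing R
  exists_hasInjectiveDimensionLE : ∃ d : ℕ, HasInjectiveDimensionLE (ModuleCat.of R R) d

/-- A scheme is *Gorenstein* if it is locally Noetherian and all of its local rings are
Gorenstein. -/
structure IsGorensteinScheme (X : Scheme.{u}) : Prop where
  isLocallyNoetherian : IsLocallyNoetherian X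
  stalk : ∀ x : X, IsGorensteinLocalRing (X.presheaf.stalk x)

/-- A scheme is *normal* if all of its local rings are integrally closed domains. -/
structure IsNormalScheme (X : Scheme.{u}) : Prop where
  isDomain : ∀ x : X, IsDomain (X.presheaf.stalk x)
  isIntegrallyClosed : ∀ x : X, IsIntegrallyClosed (X.presheaf.stalk x)

/-! ### Blowing up -/

section Blowup

variable {R : Type u} [CommRing R] (I : Ideal R)

/-- The degree `d` part `I ^ d · t ^ d` of the Rees algebra `⨁ I ^ d · t ^ d ⊆ R[t]`. -/
noncomputable def reesGrading (d : ℕ) : Submodule R (reesAlgebra I) :=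
  (LinearMap.range (Polynomial.monomial d : R →ₗ[R] Polynomial R)).comap
    (reesAlgebra I).val.toLinearMap

theorem mem_reesGrading {d : ℕ} {f : reesAlgebra I} :
    f ∈ reesGrading I d ↔ ∃ r : R, Polynomial.monomial d r = (f : Polynomial R) :=
  Iff.rfl

instance reesGrading.gradedMonoid : SetLike.GradedMonoid (reesGrading I) where
  one_mem := ⟨1, rfl⟩
  mul_mem := by
    rintro i j f g ⟨r, hr⟩ ⟨s, hs⟩
    refine ⟨r * s, ?_⟩
    change _ = (f : Polynomial R) * (g : Polynomial R)
    rw [← Polynomial.monomial_mul_monomial]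
    exact congrArg₂ _ hr hs

/-- The homogeneous component of degree `d` of an element of the Rees algebra. -/
noncomputable def reesComponent (d : ℕ) (f : reesAlgebra I) : reesGrading I d :=
  ⟨⟨Polynomial.monomial d ((f : Polynomial R).coeff d), reesAlgebra.monomial_mem.mpr (f.2 d)⟩,
    ⟨_, rfl⟩⟩

theorem coeff_coe_reesGrading (x : DirectSum ℕ fun i => reesGrading I i) (d : ℕ) :
    ((DirectSum.coeAddMonoidHom (reesGrading I) x : reesAlgebra I) : Polynomial R).coeff d =
      (((x d : reesGrading I d) : reesAlgebra I) : Polynomial R).coeff d := by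
  classical
  induction x using DirectSum.induction_on with
  | zero => simp
  | of i y =>
    rw [DirectSum.coeAddMonoidHom_of]
    by_cases h : i = d
    · subst h
      rw [DirectSum.of_eq_same]
    · rw [DirectSum.of_eq_of_ne _ _ _ (Ne.symm h)]
      obtain ⟨r, hr⟩ := (mem_reesGrading I).1 y.2
      rw [← hr, Polynomial.coeff_monomial, if_neg h]
      rfl
  | add x y hx hy =>
    rw [map_add, DirectSum.add_apply]
    simp [hx, hy]

noncomputable instance reesGrading.gradedAlgebra : GradedAlgebra (reesGrading I) where
  decompose' f :=
    ∑ d ∈ (f : Polynomial R).support, DirectSum.of (fun i => reesGrading I i) d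
      (reesComponent I d f)
  left_inv f := by
    apply Subtype.ext
    rw [map_sum]
    simp only [DirectSum.coeAddMonoidHom_of, AddSubmonoidClass.coe_finsetSum]
    exact ((f : Polynomial R).as_sum_support).symm
  right_inv x := by
    have key : Function.Injective (DirectSum.coeAddMonoidHom (reesGrading I)) := by
      intro a b hab
      refine DFinsupp.ext fun d => Subtype.ext (Subtype.ext ?_)
      obtain ⟨r, hr⟩ := (mem_reesGrading I).1 (a d).2
      obtain ⟨s, hs⟩ := (mem_reesGrading I).1 (b d).2
      have h := (coeff_coe_reesGrading I a d).symm.trans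
        ((congrArg (fun z : reesAlgebra I => (z : Polynomial R).coeff d) hab).trans
          (coeff_coe_reesGrading I b d))
      rw [← hr, ← hs, Polynomial.coeff_monomial, Polynomial.coeff_monomial, if_pos rfl,
        if_pos rfl] at h
      rw [← hr, ← hs, h]
    apply key
    apply Subtype.ext
    rw [map_sum]
    simp only [DirectSum.coeAddMonoidHom_of, AddSubmonoidClass.coe_finsetSum]
    exact (Polynomial.as_sum_support _).symm

/-- The blow-up `Proj (⨁ I ^ d)` of the affine scheme `Spec R` along its closed subscheme
defined by the ideal `I`. -/
noncomputable def affineBlowup : Scheme.{u} :=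
  Proj (reesGrading I)

end Blowup

/-! ### Subschemes of projective space -/

section ProjectiveSpace

attribute [local instance] MvPolynomial.gradedAlgebra

variable (k : Type u) [Field k] (n : ℕ)

/-- The projective space `ℙⁿ = Proj k[x₀, …, xₙ]`. -/
noncomputable abbrev projSpace : Scheme.{u} :=
  Proj (MvPolynomial.homogeneousSubmodule (Fin (n + 1)) k)

variable {k n}

/-- The standard affine chart `D₊(xⱼ)` of `ℙⁿ`. -/
noncomputable abbrev projChart (j : Fin (n + 1)) : (projSpace k n).Opens :=
  Proj.basicOpen (MvPolynomial.homogeneousSubmodule (Fin (n + 1)) k) (MvPolynomial.X j)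

/-- For a form `F` of degree `d`, the regular function `F / xⱼᵈ` on the chart `D₊(xⱼ)`. -/
noncomputable def dehomogenize {d : ℕ} (F : MvPolynomial (Fin (n + 1)) k)
    (hF : F.IsHomogeneous d) (j : Fin (n + 1)) : Γ(projSpace k n, projChart j) :=
  (Proj.awayToSection (MvPolynomial.homogeneousSubmodule (Fin (n + 1)) k)
    (MvPolynomial.X j)).hom
    (HomogeneousLocalization.Away.mk (MvPolynomial.homogeneousSubmodule (Fin (n + 1)) k)
      ((MvPolynomial.mem_homogeneousSubmodule 1 _).mpr (MvPolynomial.isHomogeneous_X k j)) d F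
      ((MvPolynomial.mem_homogeneousSubmodule _ _).mpr (by rwa [smul_eq_mul, mul_one])))

/-- The function to which `F / xⱼᵈ` restricts on `T`, over the chart `D₊(xⱼ)`, for a scheme `T`
with a morphism `i : T ⟶ ℙⁿ`. -/
noncomputable def restrictForm {T : Scheme.{u}} (i : T ⟶ projSpace k n) {d : ℕ}
    (F : MvPolynomial (Fin (n + 1)) k) (hF : F.IsHomogeneous d) (j : Fin (n + 1)) :
    Γ(T, i ⁻¹ᵁ projChart j) :=
  (i.app (projChart j)).hom (dehomogenize F hF j)

/-- The homogeneous ideal `I(T) ⊆ k[x₀, …, xₙ]` of a subscheme `i : T ⟶ ℙⁿ`: it is generated by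
the forms that vanish (scheme-theoretically) on `T`. -/
noncomputable def homogeneousIdealOf {T : Scheme.{u}} (i : T ⟶ projSpace k n) :
    Ideal (MvPolynomial (Fin (n + 1)) k) :=
  Ideal.span {F | ∃ (d : ℕ) (hF : F.IsHomogeneous d), ∀ j, restrictForm i F hF j = 0}

/-- `T ⊆ ℙⁿ` is a complete intersection: its homogeneous ideal is generated by a regular sequence
of forms. -/
def IsCompleteIntersection {T : Scheme.{u}} (i : T ⟶ projSpace k n) : Prop :=
  ∃ rs : List (MvPolynomial (Fin (n + 1)) k),
    (∀ F ∈ rs, ∃ d : ℕ, F.IsHomogeneous d) ∧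
    RingTheory.Sequence.IsRegular (MvPolynomial (Fin (n + 1)) k) rs ∧
    homogeneousIdealOf i = Ideal.ofList rs

/-- `a = (a₀, …, aₙ)` are homogeneous coordinates of the point `q` of `ℙⁿ`: the forms in the
homogeneous prime ideal `q` are those that vanish at `a`. -/
def IsHomogeneousCoordinates (a : Fin (n + 1) → k) (q : projSpace k n) : Prop :=
  ∀ (d : ℕ) (F : MvPolynomial (Fin (n + 1)) k), F.IsHomogeneous d →
    (F ∈ ProjectiveSpectrum.asHomogeneousIdeal
        (𝒜 := MvPolynomial.homogeneousSubmodule (Fin (n + 1)) k) q ↔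
      MvPolynomial.eval a F = 0)

/-- The linear form `∑ bⱼ xⱼ`. -/
noncomputable def linearForm (b : Fin (n + 1) → k) : MvPolynomial (Fin (n + 1)) k :=
  ∑ j, MvPolynomial.C (b j) * MvPolynomial.X j

theorem linearForm_isHomogeneous (b : Fin (n + 1) → k) : (linearForm b).IsHomogeneous 1 :=
  MvPolynomial.IsHomogeneous.sum _ _ _ fun j _ => MvPolynomial.isHomogeneous_C_mul_X (b j) j

/-- For `W ⊆ ℙⁿ`, the closed subscheme `iH : H ⟶ W` is the (scheme-theoretic) intersection of `W`
with the hyperplane `∑ bⱼ xⱼ = 0`, which does not contain `W`: over the chart `D₊(xⱼ)`, the ideal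
of `H` in `W` is generated by the restriction of `(∑ bⱼ xⱼ) / xⱼ`. -/
structure IsHyperplaneSection {W H : Scheme.{u}} (iW : W ⟶ projSpace k n) (iH : H ⟶ W)
    (b : Fin (n + 1) → k) : Prop where
  isClosedImmersion : IsClosedImmersion iH
  notMem : linearForm b ∉ homogeneousIdealOf iW
  ker_eq : ∀ j, RingHom.ker (iH.app (iW ⁻¹ᵁ projChart j)).hom =
    Ideal.span {restrictForm iW (linearForm b) (linearForm_isHomogeneous b) j}

end ProjectiveSpace

/-! ### Segre embedding and cones -/

section Segre

variable {k : Type u} [Field k] {n m : ℕ}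

variable (k n m) in
/-- The Segre map `(x, y) ↦ (xᵢ yⱼ)`, from `𝔸ⁿ⁺¹ × 𝔸ᵐ⁺¹` to `𝔸ᴺ⁺¹` with its coordinates `zᵢⱼ`, on
coordinate rings: `zᵢⱼ ↦ xᵢ yⱼ`. The variables `xᵢ` and `yⱼ` are those indexed by `Sum.inl i` and
`Sum.inr j`. -/
noncomputable def segreHom : MvPolynomial (Fin (n + 1) × Fin (m + 1)) k →ₐ[k]
    MvPolynomial (Fin (n + 1) ⊕ Fin (m + 1)) k :=
  MvPolynomial.aeval fun ij =>
    MvPolynomial.X (Sum.inl ij.1) * MvPolynomial.X (Sum.inr ij.2)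

/-- The homogeneous ideal in `k[zᵢⱼ]` of `S × T`, embedded in `ℙᴺ` by the Segre embedding, for
subschemes `S ⊆ ℙⁿ` and `T ⊆ ℙᵐ`: `F(zᵢⱼ)` vanishes on `S × T` if and only if `F(xᵢ yⱼ)` lies in
the ideal of `k[x, y]` that is generated by the equations `I(S)` and `I(T)` of `S` and `T`.
This is also the ideal of the affine cone `C(S × T) ⊆ 𝔸ᴺ⁺¹`. -/
noncomputable def segreIdeal {S T : Scheme.{u}} (iS : S ⟶ projSpace k n)
    (iT : T ⟶ projSpace k m) : Ideal (MvPolynomial (Fin (n + 1) × Fin (m + 1)) k) :=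
  Ideal.comap (segreHom k n m)
    ((homogeneousIdealOf iS).map (MvPolynomial.rename (R := k) Sum.inl) ⊔
      (homogeneousIdealOf iT).map (MvPolynomial.rename (R := k) Sum.inr))

/-- The coordinate ring of the affine cone `C(S × T) ⊆ 𝔸ᴺ⁺¹`. -/
abbrev segreConeRing {S T : Scheme.{u}} (iS : S ⟶ projSpace k n) (iT : T ⟶ projSpace k m) :
    Type u :=
  MvPolynomial (Fin (n + 1) × Fin (m + 1)) k ⧸ segreIdeal iS iT

/-- The ideal of `C(V × H)` in the coordinate ring of `C(V × W)`, for `iH : H ⟶ W`. -/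
noncomputable def segreConeIdeal {V W H : Scheme.{u}} (iV : V ⟶ projSpace k n)
    (iW : W ⟶ projSpace k m) (iH : H ⟶ W) : Ideal (segreConeRing iV iW) :=
  (segreIdeal iV (iH ≫ iW)).map (Ideal.Quotient.mk (segreIdeal iV iW))

/-- The blow-up of the affine cone `C(V × W)` along `C(V × H)`, for `iH : H ⟶ W`. -/
noncomputable def segreConeBlowup {V W H : Scheme.{u}} (iV : V ⟶ projSpace k n)
    (iW : W ⟶ projSpace k m) (iH : H ⟶ W) : Scheme.{u} :=
  affineBlowup (segreConeIdeal iV iW iH)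

/-- For a point `p` of `V`, the subscheme `{p} × H` of `{p} × W` is its intersection with a
hyperplane `∑ cᵢⱼ zᵢⱼ = 0` of `ℙᴺ` that does not contain `{p} × W`. Where `p = (a₀ : … : aₙ)`, this
hyperplane restricts to the hyperplane `∑ⱼ (∑ᵢ cᵢⱼ aᵢ) yⱼ = 0` of `{p} × ℙᵐ = ℙᵐ`. -/
def IsHyperplaneSectionAt {V W H : Scheme.{u}} (iV : V ⟶ projSpace k n)
    (iW : W ⟶ projSpace k m) (iH : H ⟶ W) (p : V) : Prop :=
  ∃ (a : Fin (n + 1) → k) (c : Fin (n + 1) → Fin (m + 1) → k),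
    IsHomogeneousCoordinates a (iV p) ∧ IsHyperplaneSection iW iH fun j => ∑ i, c i j * a i

end Segre

/-! ### Global dimension of polynomial rings -/

section PolynomialModule

open Polynomial

variable {A : Type u} [CommRing A]

/-- For an `A[X]`-module `M`, the `A[X]`-linear map `M[X] → M` that evaluates at `X`. -/
noncomputable def polynomialModuleEval (M : Type u) [AddCommGroup M] [Module A M] [Module A[X] M]
    [IsScalarTower A A[X] M] : PolynomialModule A M →ₗ[A[X]] M where
  toFun q := PolynomialModule.eval (X : A[X]) (PolynomialModule.map A[X] (LinearMap.id : M →ₗ[A] M) q)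
  map_add' _ _ := by simp only [map_add]
  map_smul' p q := by
    rw [PolynomialModule.map_smul, PolynomialModule.eval_smul, Polynomial.algebraMap_eq,
      Polynomial.eval_map, Polynomial.eval₂_C_X]
    rfl

theorem polynomialModuleEval_single (M : Type u) [AddCommGroup M] [Module A M] [Module A[X] M]
    [IsScalarTower A A[X] M] (i : ℕ) (m : M) :
    polynomialModuleEval M (PolynomialModule.single A i m) = (X : A[X]) ^ i • m := by
  change PolynomialModule.eval (X : A[X]) (PolynomialModule.map A[X] (LinearMap.id : M →ₗ[A] M) _) = _
  rw [PolynomialModule.map_single, PolynomialModule.eval_single]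
  rfl

/-- For an `A[X]`-module `M`, multiplication by `X` on the coefficients of `M[X]`. -/
noncomputable def polynomialModuleCoeffMul (M : Type u) [AddCommGroup M] [Module A M]
    [Module A[X] M] [IsScalarTower A A[X] M] : PolynomialModule A M →ₗ[A[X]] PolynomialModule A M where
  toFun q := PolynomialModule.map A (Algebra.lsmul A A M (X : A[X])) q
  map_add' _ _ := by simp only [map_add]
  map_smul' p q := by
    rw [PolynomialModule.map_smul]
    simp

theorem polynomialModuleCoeffMul_coeff (M : Type u) [AddCommGroup M] [Module A M]
    [Module A[X] M] [IsScalarTower A A[X] M] (q : PolynomialModule A M) (i : ℕ) :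
    (polynomialModuleCoeffMul M q).coeff i = (X : A[X]) • q.coeff i :=
  rfl

/-- The linear map `M[X] → M[X]` given by the difference of the two multiplications by `X`. -/
noncomputable def polynomialModuleDiff (M : Type u) [AddCommGroup M] [Module A M]
    [Module A[X] M] [IsScalarTower A A[X] M] : PolynomialModule A M →ₗ[A[X]] PolynomialModule A M :=
  (X : A[X]) • LinearMap.id - polynomialModuleCoeffMul M

section

theorem X_smul_polynomialModule_single (M : Type u) [AddCommGroup M] [Module A M] (i : ℕ) (m : M) :
    (X : A[X]) • PolynomialModule.single A i m = PolynomialModule.single A (i + 1) m := by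
  rw [← Polynomial.monomial_one_one_eq_X, PolynomialModule.monomial_smul_single, one_smul, add_comm]

variable (M : Type u) [AddCommGroup M] [Module A M] [Module A[X] M] [IsScalarTower A A[X] M]

theorem polynomialModuleDiff_single (i : ℕ) (m : M) :
    polynomialModuleDiff M (PolynomialModule.single A i m) =
      PolynomialModule.single A (i + 1) m - PolynomialModule.single A i ((X : A[X]) • m) := by
  change (X : A[X]) • PolynomialModule.single A i m -
    PolynomialModule.map A (Algebra.lsmul A A M (X : A[X])) (PolynomialModule.single A i m) = _
  rw [X_smul_polynomialModule_single, PolynomialModule.map_single]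
  rfl

theorem polynomialModuleDiff_injective :
    Function.Injective (polynomialModuleDiff (A := A) M) := by
  rw [injective_iff_map_eq_zero]
  intro q hq
  have h (i : ℕ) : q.coeff i = (X : A[X]) • q.coeff (i + 1) := by
    have hq' : (X : A[X]) • q = polynomialModuleCoeffMul M q := by
      rw [← sub_eq_zero]
      exact hq
    have h := congrArg (fun z : PolynomialModule A M => z.coeff (i + 1)) hq'
    simp only [← Polynomial.monomial_one_one_eq_X, PolynomialModule.monomial_smul_apply] at h
    simpa [Polynomial.monomial_one_one_eq_X, polynomialModuleCoeffMul_coeff] using h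
  have h' (j i : ℕ) : q.coeff i = (X : A[X]) ^ j • q.coeff (i + j) := by
    induction j with
    | zero => simp
    | succ j ih => rw [ih, h (i + j), smul_smul, pow_succ, add_assoc]
  rw [← PolynomialModule.coeff_eq_zero]
  ext i
  rw [h' (q.coeff.support.sup id + 1) i, Finsupp.notMem_support_iff.mp, smul_zero, Finsupp.zero_apply]
  intro hi
  have := Finset.le_sup (f := id) hi
  simp only [id] at this
  omega

theorem polynomialModuleEval_surjective : Function.Surjective (polynomialModuleEval (A := A) M) :=
  fun m => ⟨PolynomialModule.single A 0 m, by simp [polynomialModuleEval_single]⟩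

theorem polynomialModuleDiff_exact :
    Function.Exact (polynomialModuleDiff M) (polynomialModuleEval (A := A) M) := by
  have key (q : PolynomialModule A M) :
      q - PolynomialModule.single A 0 (polynomialModuleEval M q) ∈
        LinearMap.range (polynomialModuleDiff M) := by
    induction q using PolynomialModule.induction_linear with
    | zero => simp
    | add p q hp hq =>
      convert add_mem hp hq using 1
      rw [map_add, PolynomialModule.single_add]
      abel
    | single i m =>
      rw [polynomialModuleEval_single]
      induction i generalizing m with
      | zero => simp
      | succ i ih =>
        have := add_mem (ih ((X : A[X]) • m)) (LinearMap.mem_range_self (polynomialModuleDiff M)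
          (PolynomialModule.single A i m))
        rw [polynomialModuleDiff_single, smul_smul, ← pow_succ] at this
        convert this using 1
        abel
  have comp (q : PolynomialModule A M) : polynomialModuleEval M (polynomialModuleDiff M q) = 0 := by
    induction q using PolynomialModule.induction_linear with
    | zero => simp
    | add p q hp hq => rw [map_add, map_add, hp, hq, add_zero]
    | single i m =>
      rw [polynomialModuleDiff_single, map_sub, polynomialModuleEval_single,
        polynomialModuleEval_single, smul_smul, pow_succ, sub_self]
  intro q
  constructor
  · intro hq
    have := key q
    rw [hq, PolynomialModule.single_zero, sub_zero] at this
    exact this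
  · rintro ⟨q, rfl⟩
    exact comp q

end

/-- The `A[X]`-linear map `M[X] → N[X]` induced by an `A`-linear map `M → N`. -/
noncomputable def polynomialModuleMap {M N : Type u} [AddCommGroup M] [Module A M] [AddCommGroup N]
    [Module A N] (f : M →ₗ[A] N) : PolynomialModule A M →ₗ[A[X]] PolynomialModule A N where
  toFun q := PolynomialModule.map A f q
  map_add' _ _ := by simp only [map_add]
  map_smul' p q := by
    rw [PolynomialModule.map_smul]
    simp

theorem polynomialModuleMap_injective {M N : Type u} [AddCommGroup M] [Module A M] [AddCommGroup N]
    [Module A N] {f : M →ₗ[A] N} (hf : Function.Injective f) :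
    Function.Injective (polynomialModuleMap f) := by
  intro p q h
  rw [← PolynomialModule.coeff_inj]
  ext i
  exact hf (congrArg (fun z : PolynomialModule A N => z.coeff i) h)

theorem polynomialModuleMap_surjective {M N : Type u} [AddCommGroup M] [Module A M]
    [AddCommGroup N] [Module A N] {f : M →ₗ[A] N} (hf : Function.Surjective f) :
    Function.Surjective (polynomialModuleMap f) := by
  intro q
  induction q using PolynomialModule.induction_linear with
  | zero => exact ⟨0, map_zero _⟩
  | add p q hp hq =>
    obtain ⟨p', rfl⟩ := hp
    obtain ⟨q', rfl⟩ := hq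
    exact ⟨p' + q', map_add _ _ _⟩
  | single i n =>
    obtain ⟨m, rfl⟩ := hf n
    exact ⟨PolynomialModule.single A i m, PolynomialModule.map_single ..⟩

theorem polynomialModuleMap_exact {M N P : Type u} [AddCommGroup M] [Module A M]
    [AddCommGroup N] [Module A N] [AddCommGroup P] [Module A P] {f : M →ₗ[A] N} {g : N →ₗ[A] P}
    (h : Function.Exact f g) :
    Function.Exact (polynomialModuleMap f) (polynomialModuleMap g) := by
  intro q
  constructor
  · intro hq
    have hc (i : ℕ) : ∃ m, f m = q.coeff i :=
      (h _).mp (congrArg (fun z : PolynomialModule A P => z.coeff i) hq)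
    choose m hm using hc
    refine ⟨∑ i ∈ q.coeff.support, PolynomialModule.single A i (m i), ?_⟩
    rw [map_sum]
    conv_rhs => rw [← PolynomialModule.ofCoeff_coeff q, ← Finsupp.sum_single q.coeff]
    rw [Finsupp.sum, PolynomialModule.ofCoeff_sum]
    refine Finset.sum_congr rfl fun i _ => ?_
    rw [PolynomialModule.ofCoeff_single, ← hm i]
    exact PolynomialModule.map_single ..
  · rintro ⟨p, rfl⟩
    rw [← PolynomialModule.coeff_eq_zero]
    ext i
    exact (h _).mpr ⟨p.coeff i, rfl⟩

theorem hasProjectiveDimensionLE_polynomialModule (d : ℕ) (M : ModuleCat.{u} A)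
    (hM : HasProjectiveDimensionLE M d) :
    HasProjectiveDimensionLE (ModuleCat.of A[X] (PolynomialModule A M)) d := by
  have proj (M : ModuleCat.{u} A) (hM : Projective M) :
      Projective (ModuleCat.of A[X] (PolynomialModule A M)) := by
    rw [← IsProjective.iff_projective] at hM ⊢
    exact Module.Projective.of_equiv
      (PolynomialModule.polynomialTensorProductLEquivPolynomialModule A M)
  induction d generalizing M with
  | zero =>
    simp only [HasProjectiveDimensionLE, zero_add,
      ← projective_iff_hasProjectiveDimensionLT_one] at hM ⊢
    exact proj M hM
  | succ d ih =>
    let S := M.projectiveShortComplex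
    have hS : S.ShortExact := M.shortExact_projectiveShortComplex
    have h₁ := ih S.X₁ ((hS.hasProjectiveDimensionLT_X₃_iff d inferInstance).mp hM)
    have ex := polynomialModuleMap_exact
      ((ShortComplex.ShortExact.moduleCat_exact_iff_function_exact S).mp hS.exact)
    let S' : ShortComplex (ModuleCat.{u} A[X]) := ModuleCat.shortComplexOfCompEqZero
      (polynomialModuleMap S.f.hom) (polynomialModuleMap S.g.hom) ex.linearMap_comp_eq_zero
    have hS' : S'.ShortExact := ModuleCat.shortComplex_shortExact S' ex
      (polynomialModuleMap_injective ((ModuleCat.mono_iff_injective _).mp hS.mono_f))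
      (polynomialModuleMap_surjective ((ModuleCat.epi_iff_surjective _).mp hS.epi_g))
    exact (hS'.hasProjectiveDimensionLT_X₃_iff d (proj S.X₂ inferInstance)).mpr h₁

theorem Polynomial.forall_hasProjectiveDimensionLE_succ {d : ℕ}
    (hA : ∀ M : ModuleCat.{u} A, HasProjectiveDimensionLE M d) (M : ModuleCat.{u} A[X]) :
    HasProjectiveDimensionLE M (d + 1) := by
  let _ : Module A M := Module.compHom M (Polynomial.C : A →+* A[X])
  have : IsScalarTower A A[X] M := ⟨fun a p m => by
    change (a • p) • m = (C a) • p • m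
    rw [smul_smul, Polynomial.smul_eq_C_mul]⟩
  have h := hasProjectiveDimensionLE_polynomialModule d _ (hA (ModuleCat.of A M))
  have ex := polynomialModuleDiff_exact (A := A) M
  let S : ShortComplex (ModuleCat.{u} A[X]) := ModuleCat.shortComplexOfCompEqZero
    (polynomialModuleDiff (A := A) M) (polynomialModuleEval M) ex.linearMap_comp_eq_zero
  have hS : S.ShortExact := ModuleCat.shortComplex_shortExact S ex
    (polynomialModuleDiff_injective M) (polynomialModuleEval_surjective M)
  have h₂ : HasProjectiveDimensionLT S.X₂ (d + 1 + 1) :=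
    hasProjectiveDimensionLT_of_ge S.X₂ (d + 1) (d + 1 + 1) (Nat.le_succ _)
  exact hS.hasProjectiveDimensionLT_X₃ (d + 1) h h₂

end PolynomialModule

attribute [local instance] RingHomInvPair.of_ringEquiv in
theorem forall_hasProjectiveDimensionLE_of_ringEquiv {R R' : Type u} [CommRing R] [CommRing R']
    (e : R ≃+* R') {d : ℕ} (hR : ∀ M : ModuleCat.{u} R, HasProjectiveDimensionLE M d)
    (M : ModuleCat.{u} R') : HasProjectiveDimensionLE M d := by
  let _ : Module R M := Module.compHom M e.toRingHom
  let e' : ModuleCat.of R M ≃ₛₗ[RingHomClass.toRingHom e] M :=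
    { __ := AddEquiv.refl M
      map_smul' := fun _ _ => rfl }
  have := hR (ModuleCat.of R M)
  exact ModuleCat.hasProjectiveDimensionLE_of_semiLinearEquiv e e' d

theorem MvPolynomial.forall_hasProjectiveDimensionLE (k : Type u) [Field k] (n : ℕ)
    (M : ModuleCat.{u} (MvPolynomial (Fin n) k)) : HasProjectiveDimensionLE M n := by
  induction n with
  | zero =>
    refine forall_hasProjectiveDimensionLE_of_ringEquiv
      (MvPolynomial.isEmptyRingEquiv k (Fin 0)).symm (fun M => ?_) M
    simp only [HasProjectiveDimensionLE, zero_add, ← projective_iff_hasProjectiveDimensionLT_one]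
    rw [← IsProjective.iff_projective]
    exact Module.Projective.of_free
  | succ n ih =>
    exact forall_hasProjectiveDimensionLE_of_ringEquiv
      (MvPolynomial.finSuccEquiv k n).symm.toRingEquiv
      (Polynomial.forall_hasProjectiveDimensionLE_succ ih) M

theorem MvPolynomial.exists_hasInjectiveDimensionLE_self (k : Type u) [Field k] (σ : Type)
    [Finite σ] : ∃ d : ℕ, HasInjectiveDimensionLE
      (ModuleCat.of (MvPolynomial σ k) (MvPolynomial σ k)) d := by
  obtain ⟨n, ⟨e⟩⟩ := Finite.exists_equiv_fin σ
  have h := forall_hasProjectiveDimensionLE_of_ringEquiv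
    (MvPolynomial.renameEquiv k e.symm).toRingEquiv
    (MvPolynomial.forall_hasProjectiveDimensionLE k n)
  refine ⟨n, HasInjectiveDimensionLT.mk fun i hi Y x => ?_⟩
  have := h Y
  exact x.eq_zero_of_hasProjectiveDimensionLT (n + 1) hi

/-! ### Injective dimension modulo a nonzerodivisor -/

section Torsion

variable {R : Type u} [CommRing R] (a : R)

/-- The map that a linear map induces on `a`-torsion, linear over `R ⧸ (a)`. -/
noncomputable def torsionByMap {M N : Type u} [AddCommGroup M] [Module R M] [AddCommGroup N]
    [Module R N] (f : M →ₗ[R] N) :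
    Submodule.torsionBy R M a →ₗ[R ⧸ Ideal.span {a}] Submodule.torsionBy R N a where
  toFun x := ⟨f x, by
    rw [Submodule.mem_torsionBy_iff, ← map_smul, Submodule.smul_coe_torsionBy, map_zero]⟩
  map_add' x y := Subtype.ext (by simp)
  map_smul' r x := by
    obtain ⟨r, rfl⟩ := Ideal.Quotient.mk_surjective r
    exact Subtype.ext (map_smul f r (x : M))

variable {a}

theorem torsionByMap_injective {M N : Type u} [AddCommGroup M] [Module R M] [AddCommGroup N]
    [Module R N] {f : M →ₗ[R] N} (hf : Function.Injective f) :
    Function.Injective (torsionByMap a f) := fun _ _ h =>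
  Subtype.ext (hf (congrArg Subtype.val h))

theorem torsionByMap_exact {M N P : Type u} [AddCommGroup M] [Module R M] [AddCommGroup N]
    [Module R N] [AddCommGroup P] [Module R P] {f : M →ₗ[R] N} {g : N →ₗ[R] P}
    (hf : Function.Injective f) (h : Function.Exact f g) :
    Function.Exact (torsionByMap a f) (torsionByMap a g) := by
  intro x
  constructor
  · intro hx
    obtain ⟨m, hm⟩ := (h (x : N)).mp (congrArg Subtype.val hx)
    refine ⟨⟨m, ?_⟩, Subtype.ext hm⟩
    rw [Submodule.mem_torsionBy_iff]
    apply hf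
    rw [map_smul, hm, Submodule.smul_coe_torsionBy, map_zero]
  · rintro ⟨m, rfl⟩
    exact Subtype.ext ((h _).mpr ⟨(m : M), rfl⟩)

theorem torsionByMap_surjective {M N P : Type u} [AddCommGroup M] [Module R M] [AddCommGroup N]
    [Module R N] [AddCommGroup P] [Module R P] {f : M →ₗ[R] N} {g : N →ₗ[R] P}
    (h : Function.Exact f g) (hg : Function.Surjective g) (hM : ∀ m : M, ∃ m', a • m' = m) :
    Function.Surjective (torsionByMap a g) := by
  rintro ⟨p, hp⟩
  rw [Submodule.mem_torsionBy_iff] at hp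
  obtain ⟨y, rfl⟩ := hg p
  rw [← map_smul] at hp
  obtain ⟨m, hm⟩ := (h _).mp hp
  obtain ⟨m', rfl⟩ := hM m
  refine ⟨⟨y - f m', ?_⟩, Subtype.ext ?_⟩
  · rw [Submodule.mem_torsionBy_iff, smul_sub, ← hm, map_smul, sub_self]
  · change g (y - f m') = g y
    rw [map_sub, (h (f m')).mpr ⟨m', rfl⟩, sub_zero]

theorem Module.Injective.exists_smul_eq (ha : a ∈ nonZeroDivisors R) (E : Type u) [AddCommGroup E]
    [Module R E] [Module.Injective R E] (e : E) : ∃ e', a • e' = e := by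
  obtain ⟨h, hh⟩ := Module.Injective.out (LinearMap.lsmul R R a)
    (fun x y hxy => by
      have : a * x = a * y := hxy
      rw [← sub_eq_zero, ← mul_sub, mul_comm] at this
      exact sub_eq_zero.mp ((mem_nonZeroDivisors_iff_right.mp ha) _ this))
    (LinearMap.toSpanSingleton R E e)
  refine ⟨h 1, ?_⟩
  have := hh 1
  rw [LinearMap.lsmul_apply, map_smul, LinearMap.toSpanSingleton_apply, one_smul] at this
  exact this

theorem Module.Injective.torsionBy (a : R) (E : Type u) [AddCommGroup E] [Module R E]
    [Module.Injective R E] :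
    Module.Injective (R ⧸ Ideal.span {a}) (Submodule.torsionBy R E a) where
  out X Y _ _ _ _ f hf g := by
    let _ : Module R X := Module.compHom X (Ideal.Quotient.mk (Ideal.span {a}))
    let _ : Module R Y := Module.compHom Y (Ideal.Quotient.mk (Ideal.span {a}))
    let f' : X →ₗ[R] Y :=
      { toFun := f
        map_add' := map_add f
        map_smul' := fun r x => map_smul f (Ideal.Quotient.mk (Ideal.span {a}) r) x }
    let g' : X →ₗ[R] E :=
      { toFun := fun x => (g x : E)
        map_add' := fun x y => by rw [map_add]; rfl
        map_smul' := fun r x =>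
          congrArg Subtype.val (map_smul g (Ideal.Quotient.mk (Ideal.span {a}) r) x) }
    obtain ⟨h, hh⟩ := Module.Injective.out f' hf g'
    refine ⟨{ toFun := fun y => ⟨h y, ?_⟩, map_add' := ?_, map_smul' := ?_ }, ?_⟩
    · rw [Submodule.mem_torsionBy_iff, ← map_smul]
      have : a • y = (Ideal.Quotient.mk (Ideal.span {a}) a) • y := rfl
      rw [this, Ideal.Quotient.eq_zero_iff_mem.mpr (Ideal.mem_span_singleton_self a), zero_smul,
        map_zero]
    · exact fun y z => Subtype.ext (map_add h y z)
    · intro r y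
      obtain ⟨r, rfl⟩ := Ideal.Quotient.mk_surjective r
      exact Subtype.ext (map_smul h r y)
    · exact fun x => Subtype.ext (hh x)

theorem hasInjectiveDimensionLE_torsionBy (ha : a ∈ nonZeroDivisors R) (d : ℕ)
    (C : ModuleCat.{u} R) (hdiv : ∀ c : C, ∃ c', a • c' = c) (hC : HasInjectiveDimensionLE C d) :
    HasInjectiveDimensionLE
      (ModuleCat.of (R ⧸ Ideal.span {a}) (Submodule.torsionBy R C a)) d := by
  induction d generalizing C with
  | zero =>
    rw [HasInjectiveDimensionLE, zero_add, ← injective_iff_hasInjectiveDimensionLT_one] at hC ⊢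
    have : Module.Injective R C := (Module.injective_iff_injective_object R C).mpr hC
    exact (Module.injective_iff_injective_object _ _).mp (Module.Injective.torsionBy a C)
  | succ d ih =>
    let ⟨E, hE, f, hf⟩ := EnoughInjectives.presentation C
    have hE' : Module.Injective R E := (Module.injective_iff_injective_object R E).mpr hE
    have injf : Function.Injective f.hom := (ModuleCat.mono_iff_injective f).mp hf
    let S : ShortComplex (ModuleCat.{u} R) :=
      ModuleCat.shortComplexOfCompEqZero _ _ f.hom.exact_map_mkQ_range.linearMap_comp_eq_zero
    have hS : S.ShortExact := ModuleCat.shortComplex_shortExact S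
      f.hom.exact_map_mkQ_range injf (Submodule.mkQ_surjective _)
    have hdiv' : ∀ c : S.X₃, ∃ c' : S.X₃, a • c' = c := by
      intro c
      obtain ⟨e, rfl⟩ := Submodule.mkQ_surjective _ c
      obtain ⟨e', rfl⟩ := Module.Injective.exists_smul_eq ha E e
      exact ⟨Submodule.mkQ _ e', (map_smul _ _ _).symm⟩
    have h₃ := ih S.X₃ hdiv' ((hS.hasInjectiveDimensionLT_X₃_iff d hE).mpr hC)
    have ex := torsionByMap_exact (a := a) injf f.hom.exact_map_mkQ_range
    let S' : ShortComplex (ModuleCat.{u} (R ⧸ Ideal.span {a})) :=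
      ModuleCat.shortComplexOfCompEqZero _ _ ex.linearMap_comp_eq_zero
    have hS' : S'.ShortExact := ModuleCat.shortComplex_shortExact S' ex
      (torsionByMap_injective injf) (torsionByMap_surjective f.hom.exact_map_mkQ_range
        (Submodule.mkQ_surjective _) hdiv)
    have h₂ : Injective S'.X₂ := (Module.injective_iff_injective_object _ _).mp
      (Module.Injective.torsionBy a E)
    exact (hS'.hasInjectiveDimensionLT_X₃_iff d h₂).mp h₃

theorem exists_retraction_torsionBy_quotient_range (ha : a ∈ nonZeroDivisors R) (E : Type u)
    [AddCommGroup E] [Module R E] [Module.Injective R E] (f : R →ₗ[R] E)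
    (hf : Function.Injective f) :
    ∃ (i : (R ⧸ Ideal.span {a}) →ₗ[R ⧸ Ideal.span {a}]
        Submodule.torsionBy R (E ⧸ LinearMap.range f) a)
      (p : Submodule.torsionBy R (E ⧸ LinearMap.range f) a →ₗ[R ⧸ Ideal.span {a}]
        (R ⧸ Ideal.span {a})), p ∘ₗ i = LinearMap.id := by
  have hfr (r : R) : f r = r • f 1 := by rw [← map_smul, smul_eq_mul, mul_one]
  obtain ⟨e₀, he₀⟩ := Module.Injective.exists_smul_eq ha E (f 1)
  let q := (LinearMap.range f).mkQ
  have hq (e : E) : q e = 0 ↔ ∃ r : R, f r = e :=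
    (Submodule.Quotient.mk_eq_zero _).trans Iff.rfl
  have hc : q e₀ ∈ Submodule.torsionBy R (E ⧸ LinearMap.range f) a := by
    rw [Submodule.mem_torsionBy_iff, ← map_smul, he₀, hq]
    exact ⟨1, rfl⟩
  let φ : (Submodule.torsionBy R E a × (R ⧸ Ideal.span {a})) →ₗ[R ⧸ Ideal.span {a}]
      Submodule.torsionBy R (E ⧸ LinearMap.range f) a :=
    (torsionByMap a q).coprod (LinearMap.toSpanSingleton _ _ ⟨q e₀, hc⟩)
  have hφ (e : Submodule.torsionBy R E a) (r : R) :
      (φ (e, Ideal.Quotient.mk _ r) : E ⧸ LinearMap.range f) = q ((e : E) + r • e₀) := by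
    rw [map_add, map_smul]
    rfl
  have bij : Function.Bijective φ := by
    constructor
    · rw [injective_iff_map_eq_zero]
      rintro ⟨e, r⟩ h
      obtain ⟨r, rfl⟩ := Ideal.Quotient.mk_surjective r
      obtain ⟨s, hs⟩ := (hq _).mp ((hφ e r).symm.trans (congrArg Subtype.val h))
      have h₂ : a * s = r := hf <| by
        rw [hfr r, ← smul_eq_mul, map_smul, hs, smul_add, Submodule.smul_coe_torsionBy, zero_add,
          smul_comm, he₀]
      have hr : Ideal.Quotient.mk (Ideal.span {a}) r = 0 :=
        Ideal.Quotient.eq_zero_iff_mem.mpr (Ideal.mem_span_singleton'.mpr ⟨s, by rw [mul_comm, h₂]⟩)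
      have he : (e : E) = 0 := by
        rw [← h₂, mul_smul, smul_comm, he₀, ← hfr] at hs
        simpa using hs
      exact Prod.ext (Subtype.ext he) hr
    · rintro ⟨c, hc⟩
      obtain ⟨e, rfl⟩ := Submodule.mkQ_surjective _ c
      rw [Submodule.mem_torsionBy_iff, ← map_smul] at hc
      obtain ⟨r, hr⟩ := (hq (a • e)).mp hc
      refine ⟨(⟨e - r • e₀, ?_⟩, Ideal.Quotient.mk _ r), Subtype.ext ?_⟩
      · rw [Submodule.mem_torsionBy_iff, smul_sub, smul_comm, he₀, ← hfr, hr, sub_self]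
      · rw [hφ, sub_add_cancel]
  refine ⟨φ ∘ₗ LinearMap.inr _ _ _,
    LinearMap.snd _ _ _ ∘ₗ (LinearEquiv.ofBijective φ bij).symm.toLinearMap, ?_⟩
  refine LinearMap.ext fun x => ?_
  change ((LinearEquiv.ofBijective φ bij).symm (LinearEquiv.ofBijective φ bij (0, x))).2 = x
  rw [LinearEquiv.symm_apply_apply]

theorem exists_hasInjectiveDimensionLE_quotient_span_singleton (ha : a ∈ nonZeroDivisors R)
    (hR : ∃ d, HasInjectiveDimensionLE (ModuleCat.of R R) d) :
    ∃ d, HasInjectiveDimensionLE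
      (ModuleCat.of (R ⧸ Ideal.span {a}) (R ⧸ Ideal.span {a})) d := by
  obtain ⟨d, hd⟩ := hR
  have hd : HasInjectiveDimensionLT (ModuleCat.of R R) (d + 2) :=
    hasInjectiveDimensionLT_of_ge _ (d + 1) (d + 2) (Nat.le_succ _)
  let ⟨E, hE, f, hf⟩ := EnoughInjectives.presentation (ModuleCat.of R R)
  have hE' : Module.Injective R E := (Module.injective_iff_injective_object R E).mpr hE
  have injf : Function.Injective f.hom := (ModuleCat.mono_iff_injective f).mp hf
  let S : ShortComplex (ModuleCat.{u} R) :=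
    ModuleCat.shortComplexOfCompEqZero _ _ f.hom.exact_map_mkQ_range.linearMap_comp_eq_zero
  have hS : S.ShortExact := ModuleCat.shortComplex_shortExact S
    f.hom.exact_map_mkQ_range injf (Submodule.mkQ_surjective _)
  have hdiv : ∀ c : S.X₃, ∃ c' : S.X₃, a • c' = c := by
    intro c
    obtain ⟨e, rfl⟩ := Submodule.mkQ_surjective _ c
    obtain ⟨e', rfl⟩ := Module.Injective.exists_smul_eq ha E e
    exact ⟨Submodule.mkQ _ e', (map_smul _ _ _).symm⟩
  have h₃ := hasInjectiveDimensionLE_torsionBy ha d S.X₃ hdiv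
    ((hS.hasInjectiveDimensionLT_X₃_iff d hE).mpr hd)
  obtain ⟨i, p, hip⟩ := exists_retraction_torsionBy_quotient_range ha E f.hom injf
  exact ⟨d, Retract.hasInjectiveDimensionLT
    { i := ModuleCat.ofHom i
      r := ModuleCat.ofHom p
      retract := by rw [← ModuleCat.ofHom_comp, hip]; rfl } (d + 1)⟩

end Torsion

attribute [local instance] RingHomInvPair.of_ringEquiv in
theorem exists_hasInjectiveDimensionLE_of_ringEquiv {R R' : Type u} [CommRing R] [CommRing R']
    (e : R ≃+* R') (hR : ∃ d, HasInjectiveDimensionLE (ModuleCat.of R R) d) :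
    ∃ d, HasInjectiveDimensionLE (ModuleCat.of R' R') d := by
  obtain ⟨d, hd⟩ := hR
  exact ⟨d, (ModuleCat.hasInjectiveDimensionLE_iff_of_semiLinearEquiv (M := ModuleCat.of R R)
    (N := ModuleCat.of R' R') e e.toSemilinearEquiv d).mp hd⟩

theorem isWeaklyRegular_append_iff_quotient {R : Type*} [CommRing R] (rs₁ rs₂ : List R) :
    RingTheory.Sequence.IsWeaklyRegular R (rs₁ ++ rs₂) ↔
      RingTheory.Sequence.IsWeaklyRegular R rs₁ ∧
        RingTheory.Sequence.IsWeaklyRegular (R ⧸ Ideal.ofList rs₁)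
          (rs₂.map (algebraMap R (R ⧸ Ideal.ofList rs₁))) := by
  rw [RingTheory.Sequence.isWeaklyRegular_append_iff,
    RingTheory.Sequence.isWeaklyRegular_map_algebraMap_iff]
  have h : Ideal.ofList rs₁ • (⊤ : Submodule R R) = Ideal.ofList rs₁ := by
    rw [smul_eq_mul, ← Ideal.one_eq_top, mul_one]
  rw [(Submodule.quotEquivOfEq _ _ h).isWeaklyRegular_congr]

theorem exists_hasInjectiveDimensionLE_quotient_ofList {R : Type u} [CommRing R] (rs : List R)
    (hrs : RingTheory.Sequence.IsWeaklyRegular R rs)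
    (hR : ∃ d, HasInjectiveDimensionLE (ModuleCat.of R R) d) :
    ∃ d, HasInjectiveDimensionLE
      (ModuleCat.of (R ⧸ Ideal.ofList rs) (R ⧸ Ideal.ofList rs)) d := by
  generalize hn : rs.length = n
  induction n generalizing R with
  | zero =>
    rw [List.length_eq_zero_iff] at hn
    subst hn
    refine exists_hasInjectiveDimensionLE_of_ringEquiv ?_ hR
    exact (RingEquiv.quotientBot R).symm.trans (Ideal.quotEquivOfEq Ideal.ofList_nil.symm)
  | succ n ih =>
    match rs with
    | r :: rs =>
      rw [← List.singleton_append, isWeaklyRegular_append_iff_quotient, Ideal.ofList_singleton,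
        RingTheory.Sequence.isWeaklyRegular_singleton_iff] at hrs
      have hr : r ∈ nonZeroDivisors R := by
        rw [mem_nonZeroDivisors_iff_right]
        intro x hx
        exact hrs.1.right_eq_zero_of_smul (by rw [smul_eq_mul, mul_comm, hx])
      have h := exists_hasInjectiveDimensionLE_quotient_span_singleton hr hR
      refine exists_hasInjectiveDimensionLE_of_ringEquiv ?_ (ih _ hrs.2 h (by simpa using hn))
      refine (Ideal.quotEquivOfEq (Ideal.map_ofList _ _).symm).trans
        ((DoubleQuot.quotQuotEquivQuotSup _ _).trans (Ideal.quotEquivOfEq ?_))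
      rw [Ideal.ofList_cons]

theorem IsGorensteinLocalRing.localization_atPrime {R : Type u} [CommRing R] [IsNoetherianRing R]
    (hR : ∃ d, HasInjectiveDimensionLE (ModuleCat.of R R) d) (p : Ideal R) [p.IsPrime] :
    IsGorensteinLocalRing (Localization.AtPrime p) where
  isLocalRing := inferInstance
  isNoetherianRing := IsLocalization.isNoetherianRing p.primeCompl _ inferInstance
  exists_hasInjectiveDimensionLE := by
    obtain ⟨d, hd⟩ := hR
    have h := ModuleCat.localizedModule_hasInjectiveDimensionLE d p.primeCompl (ModuleCat.of R R)
    refine ⟨d, (ModuleCat.hasInjectiveDimensionLE_iff_of_linearEquiv (N := ModuleCat.of _ _) ?_ d).mp h⟩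
    exact (Shrink.linearEquiv _ _)

theorem IsGorensteinLocalRing.of_ringEquiv {R R' : Type u} [CommRing R] [CommRing R']
    (e : R ≃+* R') (hR : IsGorensteinLocalRing R) : IsGorensteinLocalRing R' where
  isLocalRing := have := hR.isLocalRing; e.isLocalRing
  isNoetherianRing := have := hR.isNoetherianRing; isNoetherianRing_of_ringEquiv R e
  exists_hasInjectiveDimensionLE :=
    exists_hasInjectiveDimensionLE_of_ringEquiv e hR.exists_hasInjectiveDimensionLE

/-! ### Depth and dimension of quotients by regular sequences -/

theorem subsingleton_ext_quotient_of_isWeaklyRegular {R : Type u} [CommRing R]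
    (N M : ModuleCat.{u} R) (rs : List R) (hrs : RingTheory.Sequence.IsWeaklyRegular M rs) (n : ℕ)
    (h : ∀ i < n + rs.length, Subsingleton (Abelian.Ext N M i)) :
    ∀ i < n, Subsingleton
      (Abelian.Ext N (ModuleCat.of R (M ⧸ (Ideal.ofList rs • ⊤ : Submodule R M))) i) := by
  induction rs generalizing M with
  | nil =>
    intro i hi
    have := h i (by simpa using hi)
    let e : M ≅ ModuleCat.of R (M ⧸ (Ideal.ofList ([] : List R) • ⊤ : Submodule R M)) :=
      (Submodule.quotEquivOfEqBot _ (by rw [Ideal.ofList_nil, Submodule.bot_smul])).symm.toModuleIso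
    have h : Function.Injective ((Abelian.Ext.mk₀ e.inv).postcomp N (add_zero i)) := by
      intro x y hxy
      have := congrArg (fun z => z.comp (Abelian.Ext.mk₀ e.hom) (add_zero i)) hxy
      simpa using this
    exact h.subsingleton
  | cons r rs ih =>
    intro i hi
    rw [RingTheory.Sequence.isWeaklyRegular_cons_iff] at hrs
    have h' := ih (ModuleCat.of R (QuotSMulTop r M)) hrs.2 (fun i hi => by
      have zero₁ := AddCommGrpCat.isZero_of_iff_subsingleton.mpr
        (h i (by rw [List.length_cons]; omega))
      have zero₂ := AddCommGrpCat.isZero_of_iff_subsingleton.mpr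
        (h (i + 1) (by rw [List.length_cons]; omega))
      exact AddCommGrpCat.subsingleton_of_isZero <| ShortComplex.Exact.isZero_of_both_zeros
        ((Abelian.Ext.covariant_sequence_exact₃' N hrs.1.smulShortComplex_shortExact) i (i + 1) rfl)
        (zero₁.eq_zero_of_src _) (zero₂.eq_zero_of_tgt _)) i hi
    let e : ModuleCat.of R (QuotSMulTop r M ⧸ (Ideal.ofList rs • ⊤ : Submodule R (QuotSMulTop r M))) ≅
        ModuleCat.of R (M ⧸ (Ideal.ofList (r :: rs) • ⊤ : Submodule R M)) :=
      (Submodule.quotOfListConsSMulTopEquivQuotSMulTopInner M r rs).symm.toModuleIso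
    have h : Function.Injective ((Abelian.Ext.mk₀ e.inv).postcomp N (add_zero i)) := by
      intro x y hxy
      have := congrArg (fun z => z.comp (Abelian.Ext.mk₀ e.hom) (add_zero i)) hxy
      simpa using this
    exact h.subsingleton

theorem mem_ofList_of_isRegular {R : Type u} [CommRing R] [IsNoetherianRing R] (I : Ideal R)
    (xs : List R) (hxs : RingTheory.Sequence.IsRegular R xs) (hI : Ideal.ofList xs ≤ I)
    (rs : List R) (hrs : RingTheory.Sequence.IsWeaklyRegular R rs) (hlen : rs.length < xs.length)
    (f : R) (hf : ∀ a ∈ I, a * f ∈ Ideal.ofList rs) : f ∈ Ideal.ofList rs := by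
  have hJ (J : Ideal R) : J • (⊤ : Submodule R R) = J := by
    rw [smul_eq_mul, ← Ideal.one_eq_top, mul_one]
  by_cases hItop : I = ⊤
  · simpa using hf 1 (hItop ▸ Submodule.mem_top)
  have hext := ModuleCat.subsingleton_ext_of_exists_isRegular I (ModuleCat.of R (R ⧸ I))
    (by rw [Module.support_eq_zeroLocus, Ideal.annihilator_quotient]) (ModuleCat.of R R)
    (by rw [hJ]; exact lt_top_iff_ne_top.mpr hItop) xs
    (fun r hr => hI (Ideal.subset_span hr)) hxs
  have h0 := subsingleton_ext_quotient_of_isWeaklyRegular (ModuleCat.of R (R ⧸ I))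
    (ModuleCat.of R R) rs hrs 1 (fun i hi => hext i (by omega)) 0 one_pos
  have h1 := Abelian.Ext.addEquiv₀.subsingleton_congr.mp h0
  have h2 : Subsingleton ((R ⧸ I) →ₗ[R] (R ⧸ (Ideal.ofList rs • ⊤ : Submodule R R))) :=
    (ModuleCat.homAddEquiv (M := ModuleCat.of R (R ⧸ I))
      (N := ModuleCat.of R (R ⧸ (Ideal.ofList rs • ⊤ : Submodule R R)))).symm.subsingleton
  have hker : I ≤ LinearMap.ker ((Ideal.ofList rs • (⊤ : Submodule R R)).mkQ ∘ₗ
      LinearMap.toSpanSingleton R R f) := by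
    intro a ha
    simp only [LinearMap.mem_ker, LinearMap.comp_apply,
      LinearMap.toSpanSingleton_apply, Submodule.mkQ_apply, Submodule.Quotient.mk_eq_zero, hJ]
    exact hf a ha
  have h3 := LinearMap.congr_fun
    (Subsingleton.elim (Submodule.liftQ I _ hker) 0) (Submodule.Quotient.mk 1)
  rw [Submodule.liftQ_apply, LinearMap.comp_apply, LinearMap.toSpanSingleton_apply, one_smul,
    LinearMap.zero_apply, Submodule.mkQ_apply, Submodule.Quotient.mk_eq_zero, hJ] at h3
  exact h3

section Variables

variable {k : Type u} [Field k] {n : ℕ}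

theorem MvPolynomial.isWeaklyRegular_ofFn_X :
    RingTheory.Sequence.IsWeaklyRegular (MvPolynomial (Fin n) k)
      (List.ofFn (X : Fin n → MvPolynomial (Fin n) k)) := by
  rw [RingTheory.Sequence.isWeaklyRegular_iff]
  intro i hi
  rw [List.length_ofFn] at hi
  rw [isSMulRegular_quotient_iff_mem_of_smul_mem]
  have hI : Ideal.ofList (List.take i (List.ofFn (X : Fin n → MvPolynomial (Fin n) k))) •
      (⊤ : Submodule (MvPolynomial (Fin n) k) (MvPolynomial (Fin n) k)) =
      Ideal.span (X '' {j : Fin n | (j : ℕ) < i}) := by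
    rw [smul_eq_mul, ← Ideal.one_eq_top, mul_one, Ideal.ofList]
    congr 1
    ext f
    simp only [Set.mem_ofPred_eq, List.mem_take_iff_getElem, List.getElem_ofFn, Set.mem_image]
    constructor
    · rintro ⟨j, hj, rfl⟩
      simp only [List.length_ofFn, lt_inf_iff] at hj
      exact ⟨⟨j, hj.2⟩, hj.1, rfl⟩
    · rintro ⟨j, hj, rfl⟩
      exact ⟨j, by simp only [List.length_ofFn, lt_inf_iff]; exact ⟨hj, j.2⟩, rfl⟩
  rw [hI]
  intro f hf
  rw [List.getElem_ofFn, smul_eq_mul] at hf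
  rw [mem_ideal_span_X_image] at hf ⊢
  intro m hm
  obtain ⟨j, hj, hj'⟩ := hf (Finsupp.single ⟨i, hi⟩ 1 + m) (by
    rw [mem_support_iff, coeff_X_mul]
    exact mem_support_iff.mp hm)
  refine ⟨j, hj, ?_⟩
  rwa [Finsupp.add_apply, Finsupp.single_eq_of_ne, zero_add] at hj'
  rintro rfl
  exact lt_irrefl i hj

theorem MvPolynomial.span_range_X_ne_top (σ : Type*) :
    Ideal.span (Set.range (X : σ → MvPolynomial σ k)) ≠ ⊤ := by
  rw [Ideal.ne_top_iff_one, ← Set.image_univ, mem_ideal_span_X_image]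
  intro h
  obtain ⟨i, -, hi⟩ := h 0 (by simp)
  exact hi rfl

/-- The polynomial ring modulo a regular sequence shorter than the number of variables has no
nonzero elements that are annihilated by all variables. -/
theorem MvPolynomial.mem_ofList_of_forall_X_mul_mem
    (rs : List (MvPolynomial (Fin n) k))
    (hrs : RingTheory.Sequence.IsWeaklyRegular (MvPolynomial (Fin n) k) rs) (hn : rs.length < n)
    (f : MvPolynomial (Fin n) k) (hf : ∀ j, X j * f ∈ Ideal.ofList rs) :
    f ∈ Ideal.ofList rs := by
  have hX : Ideal.ofList (List.ofFn (X : Fin n → MvPolynomial (Fin n) k)) =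
      Ideal.span (Set.range X) := by
    rw [Ideal.ofList]
    congr 1
    ext
    simp [List.mem_ofFn]
  refine mem_ofList_of_isRegular (Ideal.span (Set.range X)) (List.ofFn X) ?_ ?_ rs hrs
    (by rwa [List.length_ofFn]) f ?_
  · refine ⟨isWeaklyRegular_ofFn_X, ?_⟩
    rw [smul_eq_mul, ← Ideal.one_eq_top, mul_one, Ideal.one_eq_top, hX]
    exact (span_range_X_ne_top (k := k) (Fin n)).symm
  · exact hX.le
  · intro a ha
    suffices h : Ideal.span (Set.range X) ≤ Submodule.comap
        (LinearMap.toSpanSingleton (MvPolynomial (Fin n) k) _ f) (Ideal.ofList rs) from h ha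
    rw [Ideal.span_le]
    rintro _ ⟨j, rfl⟩
    exact hf j

theorem MvPolynomial.mem_ofList_of_forall_exists_X_pow_mul_mem
    (rs : List (MvPolynomial (Fin n) k))
    (hrs : RingTheory.Sequence.IsWeaklyRegular (MvPolynomial (Fin n) k) rs) (hn : rs.length < n)
    (f : MvPolynomial (Fin n) k) (hf : ∀ j, ∃ e : ℕ, X j ^ e * f ∈ Ideal.ofList rs) :
    f ∈ Ideal.ofList rs := by
  choose e he using hf
  generalize hN : ∑ j, e j = N
  induction N generalizing f e with
  | zero =>
    have := he ⟨0, by omega⟩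
    rwa [Finset.sum_eq_zero_iff.mp hN _ (Finset.mem_univ _), pow_zero, one_mul] at this
  | succ N ih =>
    by_cases h0 : ∃ j, e j = 0
    · obtain ⟨j, hj⟩ := h0
      have := he j
      rwa [hj, pow_zero, one_mul] at this
    push Not at h0
    refine mem_ofList_of_forall_X_mul_mem rs hrs hn f fun j => ?_
    refine ih (X j * f) (Function.update e j (e j - 1)) (fun i => ?_) ?_
    · by_cases hij : i = j
      · subst hij
        rw [Function.update_self, ← mul_assoc, ← pow_succ, Nat.sub_add_cancel
          (Nat.one_le_iff_ne_zero.mpr (h0 i))]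
        exact he i
      · rw [Function.update_of_ne hij, mul_left_comm]
        exact Ideal.mul_mem_left _ _ (he i)
    · have h1 := Finset.add_sum_erase Finset.univ e (Finset.mem_univ j)
      have h2 := Finset.add_sum_erase Finset.univ (Function.update e j (e j - 1))
        (Finset.mem_univ j)
      have h3 : ∑ x ∈ Finset.univ.erase j, Function.update e j (e j - 1) x =
          ∑ x ∈ Finset.univ.erase j, e x :=
        Finset.sum_congr rfl fun x hx => Function.update_of_ne (Finset.ne_of_mem_erase hx) _ _
      rw [Function.update_self] at h2
      have := h0 j
      omega

theorem ringKrullDim_quotient_ofList_add_length_le {R : Type*} [CommRing R] (rs : List R)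
    (hrs : RingTheory.Sequence.IsWeaklyRegular R rs) :
    ringKrullDim (R ⧸ Ideal.ofList rs) + rs.length ≤ ringKrullDim R := by
  generalize hn : rs.length = n
  induction n generalizing R with
  | zero =>
    rw [Nat.cast_zero, add_zero]
    exact ringKrullDim_quotient_le _
  | succ n ih =>
    match rs with
    | r :: rs =>
      rw [← List.singleton_append, isWeaklyRegular_append_iff_quotient, Ideal.ofList_singleton,
        RingTheory.Sequence.isWeaklyRegular_singleton_iff] at hrs
      have hr : r ∈ nonZeroDivisors R := by
        rw [mem_nonZeroDivisors_iff_right]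
        intro x hx
        exact hrs.1.right_eq_zero_of_smul (by rw [smul_eq_mul, mul_comm, hx])
      have e : (R ⧸ Ideal.span {r}) ⧸ Ideal.ofList (rs.map (algebraMap R (R ⧸ Ideal.span {r}))) ≃+*
          R ⧸ Ideal.ofList (r :: rs) := by
        refine (Ideal.quotEquivOfEq (Ideal.map_ofList _ _).symm).trans
          ((DoubleQuot.quotQuotEquivQuotSup _ _).trans (Ideal.quotEquivOfEq ?_))
        rw [Ideal.ofList_cons]
      have h := ih _ hrs.2 (by simpa using hn)
      rw [ringKrullDim_eq_of_ringEquiv e] at h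
      refine le_trans ?_ (ringKrullDim_quotient_succ_le_of_nonZeroDivisor hr)
      rw [Nat.cast_succ, ← add_assoc]
      gcongr

theorem MvPolynomial.length_add_two_le_of_isWeaklyRegular (rs : List (MvPolynomial (Fin n) k))
    (hrs : RingTheory.Sequence.IsWeaklyRegular (MvPolynomial (Fin n) k) rs)
    (P Q M : PrimeSpectrum (MvPolynomial (Fin n) k)) (hPQ : P < Q) (hQM : Q < M)
    (hP : Ideal.ofList rs ≤ P.asIdeal) : rs.length + 2 ≤ n := by
  have h := ringKrullDim_quotient_ofList_add_length_le rs hrs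
  rw [ringKrullDim_quotient, MvPolynomial.ringKrullDim_of_isNoetherianRing,
    ringKrullDim_eq_zero_of_field, zero_add, Nat.card_fin] at h
  let P' : PrimeSpectrum.zeroLocus (Ideal.ofList rs : Set (MvPolynomial (Fin n) k)) := ⟨P, hP⟩
  let Q' : PrimeSpectrum.zeroLocus (Ideal.ofList rs : Set (MvPolynomial (Fin n) k)) :=
    ⟨Q, hP.trans hPQ.le⟩
  let M' : PrimeSpectrum.zeroLocus (Ideal.ofList rs : Set (MvPolynomial (Fin n) k)) :=
    ⟨M, hP.trans (hPQ.trans hQM).le⟩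
  let s : LTSeries (PrimeSpectrum.zeroLocus (Ideal.ofList rs : Set (MvPolynomial (Fin n) k))) :=
    { length := 2
      toFun := ![P', Q', M']
      step := fun i => by
        fin_cases i
        · exact hPQ
        · exact hQM }
  have hs : (2 : WithBot ℕ∞) ≤ Order.krullDim _ := Order.LTSeries.length_le_krullDim s
  have h' : ((rs.length + 2 : ℕ) : WithBot ℕ∞) ≤ (n : ℕ) := by
    refine le_trans ?_ h
    rw [Nat.cast_add, add_comm]
    gcongr
    exact hs
  exact_mod_cast h'

end Variables

/-! ### Charts of a blow-up -/

section Rees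

open Polynomial

variable {A : Type u} [CommRing A] (I : Ideal A)

/-- The element `a · t ^ d` of the Rees algebra, for `a ∈ I ^ d`. -/
noncomputable def reesMonomial (d : ℕ) (a : A) (ha : a ∈ I ^ d) : reesAlgebra I :=
  ⟨monomial d a, reesAlgebra.monomial_mem.mpr ha⟩

variable {I}

theorem reesMonomial_mem_reesGrading {d : ℕ} {a : A} (ha : a ∈ I ^ d) :
    reesMonomial I d a ha ∈ reesGrading I d :=
  ⟨a, rfl⟩

theorem exists_eq_reesMonomial {d : ℕ} {f : reesAlgebra I} (hf : f ∈ reesGrading I d) :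
    ∃ (a : A) (ha : a ∈ I ^ d), f = reesMonomial I d a ha := by
  obtain ⟨a, ha⟩ := (mem_reesGrading I).mp hf
  exact ⟨a, reesAlgebra.monomial_mem.mp (ha ▸ f.2), Subtype.ext ha.symm⟩

theorem irrelevant_reesGrading_le_span {ι : Type*} (b : ι → A) (hb : ∀ i, b i ∈ I ^ 1)
    (hI : I ≤ Ideal.span (Set.range b)) :
    (HomogeneousIdeal.irrelevant (reesGrading I)).toIdeal ≤
      Ideal.span (Set.range fun i => reesMonomial I 1 (b i) (hb i)) := by
  have key₁ (p : A) (hp : p ∈ I ^ 1) : reesMonomial I 1 p hp ∈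
      Ideal.span (Set.range fun i => reesMonomial I 1 (b i) (hb i)) := by
    have hp' : p ∈ Ideal.span (Set.range b) := hI (by rwa [pow_one] at hp)
    obtain ⟨c, rfl⟩ := Finsupp.mem_ideal_span_range_iff_exists_finsupp.mp hp'
    have : reesMonomial I 1 _ hp = c.sum fun i a => a • reesMonomial I 1 (b i) (hb i) := by
      refine Subtype.ext ?_
      unfold Finsupp.sum
      rw [AddSubmonoidClass.coe_finsetSum]
      change monomial 1 (∑ i ∈ c.support, c i * b i) = _
      rw [map_sum]
      refine Finset.sum_congr rfl fun i _ => ?_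
      change _ = c i • monomial 1 (b i)
      rw [smul_monomial, smul_eq_mul]
    rw [this]
    exact Ideal.sum_mem _ fun i _ => Submodule.smul_of_tower_mem _ _ (Ideal.subset_span ⟨i, rfl⟩)
  have key (d : ℕ) (a : A) (ha : a ∈ I ^ (d + 1)) : reesMonomial I (d + 1) a ha ∈
      Ideal.span (Set.range fun i => reesMonomial I 1 (b i) (hb i)) := by
    have ha' := ha
    rw [pow_succ'] at ha'
    induction ha' using Submodule.mul_induction_on' with
    | mem_mul_mem p hp q hq =>
      have : reesMonomial I (d + 1) (p * q) ha =
          reesMonomial I d q hq * reesMonomial I 1 p (by rwa [pow_one]) := by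
        refine Subtype.ext ?_
        change monomial (d + 1) (p * q) = monomial d q * monomial 1 p
        rw [monomial_mul_monomial, mul_comm]
      rw [this]
      exact Ideal.mul_mem_left _ _ (key₁ p _)
    | add x hx y hy hx' hy' =>
      rw [← pow_succ'] at hx hy
      have : reesMonomial I (d + 1) (x + y) ha =
          reesMonomial I (d + 1) x hx + reesMonomial I (d + 1) y hy :=
        Subtype.ext (map_add _ _ _)
      rw [this]
      exact add_mem (hx' hx) (hy' hy)
  intro f hf
  classical
  rw [← DirectSum.sum_support_decompose (reesGrading I) f]
  refine Ideal.sum_mem _ fun d _ => ?_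
  cases d with
  | zero =>
    have : ((DirectSum.decompose (reesGrading I) f) 0 : reesAlgebra I) = 0 :=
      (HomogeneousIdeal.mem_irrelevant_iff _ _).mp hf
    rw [this]
    exact zero_mem _
  | succ d =>
    obtain ⟨a, ha, h⟩ := exists_eq_reesMonomial ((DirectSum.decompose (reesGrading I) f) (d + 1)).2
    rw [h]
    exact key d a ha

/-- If `I ^ d` maps into `l ^ d T` for all `d`, where `l` is a nonzerodivisor of `T`, then there is
a homomorphism from the Rees algebra to `T` that maps `a · t ^ d` to `a / l ^ d`. -/
theorem exists_reesAlgebra_ringHom {T : Type*} [CommRing T] (φ : A →+* T) {l : T}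
    (hl : l ∈ nonZeroDivisors T) (hI : ∀ a ∈ I, l ∣ φ a) :
    ∃ θ : reesAlgebra I →+* T, ∀ (d : ℕ) (a : A) (ha : a ∈ I ^ d) (u : T), φ a = l ^ d * u →
      θ (reesMonomial I d a ha) = u := by
  let s : T[X] →+* T[X] := compRingHom (C l * X)
  have hs_coeff (p : T[X]) (d : ℕ) : (s p).coeff d = p.coeff d * l ^ d := by
    rw [coe_compRingHom_apply, comp_C_mul_X_coeff]
  have hs : Function.Injective s := by
    rw [injective_iff_map_eq_zero]
    intro p hp
    ext d
    have h := hs_coeff p d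
    rw [hp, coeff_zero] at h
    exact (mul_right_mem_nonZeroDivisors_eq_zero_iff (pow_mem hl d)).mp h.symm
  have hs_mono (d : ℕ) (u : T) : s (monomial d u) = monomial d (l ^ d * u) := by
    ext i
    rw [hs_coeff, coeff_monomial, coeff_monomial]
    split_ifs with h
    · rw [h, mul_comm]
    · rw [zero_mul]
  have hId (d : ℕ) (a : A) (ha : a ∈ I ^ d) : ∃ u, φ a = l ^ d * u := by
    have h1 : I.map φ ≤ Ideal.span {l} := by
      rw [Ideal.map_le_iff_le_comap]
      intro a ha
      exact Ideal.mem_span_singleton.mpr (hI a ha)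
    have h2 := Ideal.pow_right_mono h1 d
    rw [Ideal.span_singleton_pow, ← Ideal.map_pow] at h2
    exact Ideal.mem_span_singleton.mp (h2 (Ideal.mem_map_of_mem φ ha))
  let ψ : reesAlgebra I →+* T[X] := (mapRingHom φ).comp (reesAlgebra I).val.toRingHom
  have hψ (f : reesAlgebra I) : ψ f ∈ s.range := by
    change (f : A[X]).map φ ∈ s.range
    rw [as_sum_support (f : A[X]), Polynomial.map_sum]
    refine sum_mem fun d _ => ?_
    obtain ⟨u, hu⟩ := hId d _ (f.2 d)
    exact ⟨monomial d u, by rw [hs_mono, ← hu, map_monomial]⟩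
  let e : T[X] ≃+* s.range := RingEquiv.ofBijective s.rangeRestrict
    ⟨fun x y h => hs (congrArg Subtype.val h), s.rangeRestrict_surjective⟩
  refine ⟨(evalRingHom 1).comp (e.symm.toRingHom.comp (ψ.codRestrict s.range hψ)), ?_⟩
  intro d a ha u hu
  have : e.symm (ψ.codRestrict s.range hψ (reesMonomial I d a ha)) = monomial d u := by
    rw [RingEquiv.symm_apply_eq]
    refine Subtype.ext ?_
    change (monomial d a).map φ = s (monomial d u)
    rw [hs_mono, ← hu, map_monomial]
  change eval 1 (e.symm (ψ.codRestrict s.range hψ (reesMonomial I d a ha))) = u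
  rw [this, eval_monomial, one_pow, mul_one]

/-- A chart of a blow-up: suppose that `A ⊆ T`, that `l` is a nonzerodivisor of `T` and that `U d`
are subsets of `T` such that `I ^ d` consists of the elements `l ^ d * u` for `u ∈ U d`. If, moreover,
`x ∈ U 1` is such that every element of `T` is congruent modulo `x - 1` to one of some `U d`, and
an element of `U d` that is divisible by `x - 1` is annihilated by a power of `x`, then the chart
of the blow-up on which `I` is generated by `l * x` is the spectrum of `T ⧸ (x - 1)`. -/
theorem nonempty_reesAway_ringEquiv {T : Type u} [CommRing T] {φ : A →+* T}
    (hφ : Function.Injective φ) {l : T} (hl : l ∈ nonZeroDivisors T) (U : ℕ → Set T)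
    (hIU : ∀ d, ∀ a ∈ I ^ d, ∃ u ∈ U d, φ a = l ^ d * u)
    (hUI : ∀ d, ∀ u ∈ U d, ∃ a ∈ I ^ d, φ a = l ^ d * u)
    {x : T}
    (hx₀ : ∀ d, ∀ u ∈ U d, x - 1 ∣ u → ∃ N : ℕ, x ^ N * u = 0)
    (hx₁ : ∀ y, ∃ d, ∃ u ∈ U d, x - 1 ∣ y - u)
    (b : A) (hb : b ∈ I ^ 1) (hbx : φ b = l * x) :
    Nonempty (HomogeneousLocalization.Away (reesGrading I) (reesMonomial I 1 b hb) ≃+*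
      T ⧸ Ideal.span {x - 1}) := by
  obtain ⟨θ, hθ⟩ := exists_reesAlgebra_ringHom (I := I) φ hl fun a ha => by
    obtain ⟨u, -, hu⟩ := hIU 1 a (by rwa [pow_one])
    exact ⟨u, by rw [hu, pow_one]⟩
  set β := reesMonomial I 1 b hb with hβ
  have hβmem : β ∈ reesGrading I 1 := reesMonomial_mem_reesGrading hb
  let q := Ideal.Quotient.mk (Ideal.span {x - 1})
  have hq (y : T) : q y = 0 ↔ x - 1 ∣ y :=
    Ideal.Quotient.eq_zero_iff_mem.trans Ideal.mem_span_singleton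
  have hqβ : (q.comp θ) β = 1 := by
    rw [RingHom.comp_apply, hθ 1 b hb x (by rw [hbx, pow_one]), ← sub_eq_zero, ← map_one q,
      ← map_sub, hq]
  let η₀ : Localization.Away β →+* T ⧸ Ideal.span {x - 1} :=
    IsLocalization.Away.lift β (g := q.comp θ) (by rw [hqβ]; exact isUnit_one)
  let η : HomogeneousLocalization.Away (reesGrading I) β →+* T ⧸ Ideal.span {x - 1} :=
    η₀.comp (algebraMap _ _)
  have hη (n : ℕ) (f : reesAlgebra I) (hf : f ∈ reesGrading I (n • 1)) :
      η (HomogeneousLocalization.Away.mk _ hβmem n f hf) = q (θ f) := by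
    change η₀ (Localization.mk f ⟨β ^ n, _⟩) = _
    have h : η₀ (algebraMap _ _ (β ^ n)) = 1 := by
      rw [IsLocalization.Away.lift_eq, map_pow, hqβ, one_pow]
    rw [← mul_one (η₀ _), ← h, ← map_mul, Localization.mk_eq_mk', IsLocalization.mk'_spec,
      IsLocalization.Away.lift_eq]
    rfl
  refine ⟨RingEquiv.ofBijective η ⟨?_, ?_⟩⟩
  · rw [injective_iff_map_eq_zero]
    intro z hz
    obtain ⟨n, f, hf, rfl⟩ := HomogeneousLocalization.Away.mk_surjective _ hβmem z
    rw [hη] at hz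
    obtain ⟨a, ha, rfl⟩ := exists_eq_reesMonomial hf
    obtain ⟨u, hu, hau⟩ := hIU _ a ha
    rw [hθ _ a ha u hau, hq] at hz
    obtain ⟨N, hN⟩ := hx₀ _ u hu hz
    have hab : a * b ^ N = 0 := by
      apply hφ
      rw [map_mul, map_pow, hbx, hau, map_zero, mul_pow]
      linear_combination (l ^ (n • 1) * l ^ N) * hN
    apply HomogeneousLocalization.val_injective
    rw [HomogeneousLocalization.Away.val_mk, HomogeneousLocalization.val_zero, Localization.mk_eq_mk',
      IsLocalization.mk'_eq_zero_iff]
    refine ⟨⟨β ^ N, N, rfl⟩, Subtype.ext ?_⟩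
    change (monomial 1 b : A[X]) ^ N * monomial (n • 1) a = 0
    rw [monomial_pow, monomial_mul_monomial, mul_comm (b ^ N), hab, monomial_zero_right]
  · intro y
    obtain ⟨y, rfl⟩ := Ideal.Quotient.mk_surjective y
    obtain ⟨d, u, hu, hyu⟩ := hx₁ y
    obtain ⟨a, ha, hau⟩ := hUI d u hu
    refine ⟨HomogeneousLocalization.Away.mk _ hβmem d (reesMonomial I d a ha) ?_, ?_⟩
    · rw [smul_eq_mul, mul_one]
      exact reesMonomial_mem_reesGrading ha
    · rw [hη, hθ d a ha u hau]
      change q u = q y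
      rw [eq_comm, ← sub_eq_zero, ← map_sub, hq]
      exact hyu

theorem isGorensteinLocalRing_stalk_Spec (R : Type u) [CommRing R] [IsNoetherianRing R]
    (hR : ∃ d, HasInjectiveDimensionLE (ModuleCat.of R R) d) (x : Spec (.of R)) :
    IsGorensteinLocalRing ((Spec (.of R)).presheaf.stalk x) := by
  let p : PrimeSpectrum R := x
  exact (IsGorensteinLocalRing.localization_atPrime hR p.asIdeal).of_ringEquiv
    (Spec.stalkIso (.of R) p).commRingCatIsoToRingEquiv.symm

theorem isGorensteinScheme_affineBlowup {ι : Type*} (b : ι → A) (hb : ∀ i, b i ∈ I ^ 1)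
    (hI : I ≤ Ideal.span (Set.range b)) (B : ι → Type u) [∀ i, CommRing (B i)]
    [∀ i, IsNoetherianRing (B i)]
    (hB : ∀ i, ∃ d, HasInjectiveDimensionLE (ModuleCat.of (B i) (B i)) d)
    (e : ∀ i, Nonempty (HomogeneousLocalization.Away (reesGrading I)
      (reesMonomial I 1 (b i) (hb i)) ≃+* B i)) :
    IsGorensteinScheme (affineBlowup I) := by
  let 𝒰 := Proj.affineOpenCoverOfIrrelevantLESpan (reesGrading I)
    (fun i => reesMonomial I 1 (b i) (hb i)) (m := fun _ => 1)
    (fun i => reesMonomial_mem_reesGrading (hb i)) (fun _ => one_pos)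
    (irrelevant_reesGrading_le_span b hb hI)
  have noeth (i : ι) : IsNoetherianRing (HomogeneousLocalization.Away (reesGrading I)
      (reesMonomial I 1 (b i) (hb i))) :=
    isNoetherianRing_of_ringEquiv (B i) (e i).some.symm
  have inj (i : ι) : ∃ d, HasInjectiveDimensionLE
      (ModuleCat.of (HomogeneousLocalization.Away (reesGrading I)
        (reesMonomial I 1 (b i) (hb i))) (HomogeneousLocalization.Away (reesGrading I)
        (reesMonomial I 1 (b i) (hb i)))) d :=
    exists_hasInjectiveDimensionLE_of_ringEquiv (e i).some.symm (hB i)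
  constructor
  · refine (isLocallyNoetherian_iff_openCover 𝒰.openCover).mpr fun i => ?_
    have := noeth i
    change IsLocallyNoetherian (Spec (.of (HomogeneousLocalization.Away (reesGrading I)
      (reesMonomial I 1 (b i) (hb i)))))
    infer_instance
  · intro x
    obtain ⟨y, hy⟩ := 𝒰.covers x
    rw [← hy]
    have := noeth (𝒰.idx x)
    exact (isGorensteinLocalRing_stalk_Spec (HomogeneousLocalization.Away (reesGrading I)
      (reesMonomial I 1 (b (𝒰.idx x)) (hb (𝒰.idx x)))) (inj (𝒰.idx x)) y).of_ringEquiv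
      (asIso ((𝒰.f (𝒰.idx x)).stalkMap y)).commRingCatIsoToRingEquiv.symm

end Rees

/-! ### Regular sequences in disjoint sets of variables -/

section Regular

open MvPolynomial RingTheory.Sequence

theorem isWeaklyRegular_map_of_flat {R S : Type*} [CommRing R] [CommRing S] (f : R →+* S)
    (hf : f.Flat) {rs : List R} (hrs : IsWeaklyRegular R rs) : IsWeaklyRegular S (rs.map f) := by
  let _ : Algebra R S := f.toAlgebra
  have : Module.Flat R S := hf
  exact hrs.of_flat (S := S)

attribute [local instance] MvPolynomial.algebraMvPolynomial in
theorem MvPolynomial.flat_map_algebraMap (k : Type u) [Field k] (τ : Type) (R : Type u)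
    [CommRing R] [Algebra k R] :
    (MvPolynomial.map (σ := τ) (algebraMap k R)).Flat := by
  have : Module.Flat (MvPolynomial τ k) (MvPolynomial τ R) :=
    Module.Flat.isBaseChange k (MvPolynomial τ k) R (MvPolynomial τ R)
      (Algebra.IsPushout.out (R := k) (S := MvPolynomial τ k) (R' := R) (S' := MvPolynomial τ R))
  exact RingHom.flat_algebraMap_iff.mpr this

theorem MvPolynomial.flat_C (R : Type u) [CommRing R] (τ : Type) :
    (C (σ := τ) (R := R)).Flat :=
  RingHom.flat_algebraMap_iff.mpr (inferInstance : Module.Flat R (MvPolynomial τ R))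

variable {k : Type u} [Field k] {σ τ : Type}

theorem MvPolynomial.flat_mk_comp_map (fs : List (MvPolynomial σ k)) :
    RingHom.Flat (R := MvPolynomial τ k)
      (S := MvPolynomial τ (MvPolynomial σ k) ⧸ Ideal.ofList (fs.map (C (σ := τ))))
      ((Ideal.Quotient.mk (Ideal.ofList (fs.map (C (σ := τ))))).comp
        (MvPolynomial.map (algebraMap k (MvPolynomial σ k)))) := by
  let e := (quotientEquivQuotientMvPolynomial (σ := τ) (Ideal.ofList fs)).toRingEquiv.trans
    (Ideal.quotEquivOfEq (Ideal.map_ofList C fs))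
  have h := (flat_map_algebraMap k τ (MvPolynomial σ k ⧸ Ideal.ofList fs)).comp
    (RingHom.Flat.of_bijective (f := e.toRingHom) e.bijective)
  convert h using 1
  refine MvPolynomial.ringHom_ext (fun a => ?_) (fun i => ?_)
  · simp [e, quotientEquivQuotientMvPolynomial,
      IsScalarTower.algebraMap_apply k (MvPolynomial σ k) (MvPolynomial σ k ⧸ Ideal.ofList fs)]
  · simp [e, quotientEquivQuotientMvPolynomial]

/-- Regular sequences in disjoint sets of variables form a regular sequence together. -/
theorem MvPolynomial.isWeaklyRegular_rename_append (fs : List (MvPolynomial σ k))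
    (gs : List (MvPolynomial τ k)) (hfs : IsWeaklyRegular (MvPolynomial σ k) fs)
    (hgs : IsWeaklyRegular (MvPolynomial τ k) gs) :
    IsWeaklyRegular (MvPolynomial (σ ⊕ τ) k)
      (fs.map (rename Sum.inl) ++ gs.map (rename Sum.inr)) := by
  let e : MvPolynomial τ (MvPolynomial σ k) ≃ₐ[k] MvPolynomial (σ ⊕ τ) k :=
    (sumAlgEquiv k τ σ).symm.trans (renameEquiv k (Equiv.sumComm τ σ))
  have h₁ : IsWeaklyRegular (MvPolynomial τ (MvPolynomial σ k))
      (fs.map C ++ gs.map (MvPolynomial.map (algebraMap k (MvPolynomial σ k)))) := by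
    rw [isWeaklyRegular_append_iff_quotient]
    refine ⟨isWeaklyRegular_map_of_flat _ (flat_C _ _) hfs, ?_⟩
    have := isWeaklyRegular_map_of_flat _ (flat_mk_comp_map (τ := τ) fs) hgs
    rwa [RingHom.coe_comp, ← List.map_map] at this
  have h₂ := isWeaklyRegular_map_of_flat e.toRingEquiv.toRingHom
    (RingHom.Flat.of_bijective e.bijective) h₁
  rw [List.map_append, List.map_map, List.map_map] at h₂
  have h₃ : fs.map (rename Sum.inl) = fs.map (e.toRingEquiv.toRingHom ∘ C) :=
    List.map_congr_left fun f _ => by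
      have : rename Sum.inl = e.toAlgHom.comp
          (IsScalarTower.toAlgHom k (MvPolynomial σ k) (MvPolynomial τ (MvPolynomial σ k))) := by
        refine MvPolynomial.algHom_ext fun i => ?_
        rw [← e.symm.injective.eq_iff]
        simp [e]
      exact congrArg (fun φ => φ f) this
  have h₄ : gs.map (rename Sum.inr) = gs.map (e.toRingEquiv.toRingHom ∘
      MvPolynomial.map (algebraMap k (MvPolynomial σ k))) :=
    List.map_congr_left fun f _ => by
      have : rename Sum.inr = e.toAlgHom.comp
          (MvPolynomial.mapAlgHom (Algebra.ofId k (MvPolynomial σ k))) := by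
        refine MvPolynomial.algHom_ext fun i => ?_
        rw [← e.symm.injective.eq_iff]
        simp [e]
      exact congrArg (fun φ => φ f) this
  rw [h₃, h₄]
  exact h₂

end Regular

/-! ### Homogeneous ideals of `ℤ`-graded rings -/

section Graded

variable {Q S : Type*} [CommRing Q] [SetLike S Q] [AddSubgroupClass S Q] (𝒬 : ℤ → S)
  [GradedRing 𝒬] {J : Ideal Q}

theorem exists_forall_decompose_eq_zero (r : Q) :
    ∃ M : ℕ, ∀ e : ℤ, (M : ℤ) ≤ |e| → (DirectSum.decompose 𝒬 r e : Q) = 0 := by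
  classical
  refine ⟨(DirectSum.decompose 𝒬 r).support.sup Int.natAbs + 1, fun e he => ?_⟩
  by_contra h
  have : e ∈ (DirectSum.decompose 𝒬 r).support := by
    rw [DFinsupp.mem_support_iff]
    exact fun h' => h (by rw [h']; rfl)
  have := Finset.le_sup (f := Int.natAbs) this
  rw [← Int.natCast_natAbs] at he
  omega

variable {𝒬}

theorem mul_decompose_sub_decompose_mem (hJ : J.IsHomogeneous 𝒬) {x : Q} (hx : x ∈ 𝒬 1) {d : ℤ}
    {q r : Q} (hq : q ∈ 𝒬 d) (h : (x - 1) * r - q ∈ J) {e : ℤ} (he : e + 1 ≠ d) :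
    x * DirectSum.decompose 𝒬 r e - DirectSum.decompose 𝒬 r (e + 1) ∈ J := by
  have h' := hJ (e + 1) h
  rw [sub_mul, one_mul, DirectSum.decompose_sub, DirectSum.decompose_sub, DirectSum.sub_apply,
    DirectSum.sub_apply, AddSubgroupClass.coe_sub, AddSubgroupClass.coe_sub,
    DirectSum.decompose_of_mem_ne 𝒬 hq he.symm, sub_zero, add_comm e 1,
    DirectSum.coe_decompose_mul_add_of_left_mem 𝒬 hx, add_comm 1 e] at h'
  exact h'

theorem pow_mul_decompose_sub_decompose_mem (hJ : J.IsHomogeneous 𝒬) {x : Q} (hx : x ∈ 𝒬 1)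
    {d : ℤ} {q r : Q} (hq : q ∈ 𝒬 d) (h : (x - 1) * r - q ∈ J) (e : ℤ) (N : ℕ)
    (he : d ≤ e ∨ e + N < d) :
    x ^ N * DirectSum.decompose 𝒬 r e - DirectSum.decompose 𝒬 r (e + N) ∈ J := by
  induction N with
  | zero =>
    rw [Nat.cast_zero, add_zero, pow_zero, one_mul, sub_self]
    exact zero_mem _
  | succ N ih =>
    have h₁ := Ideal.mul_mem_left J x (ih (by push_cast at he; omega))
    have h₂ := mul_decompose_sub_decompose_mem hJ hx hq h (e := e + N)
      (by push_cast at he; omega)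
    have := add_mem h₁ h₂
    rw [add_assoc] at this
    convert this using 1
    push_cast
    ring

theorem decompose_mem_of_lt (hJ : J.IsHomogeneous 𝒬) {x : Q} (hx : x ∈ 𝒬 1)
    {d : ℤ} {q r : Q} (hq : q ∈ 𝒬 d) (h : (x - 1) * r - q ∈ J) (e : ℤ) (he : e < d) :
    (DirectSum.decompose 𝒬 r e : Q) ∈ J := by
  obtain ⟨M, hM⟩ := exists_forall_decompose_eq_zero 𝒬 r
  have h' := pow_mul_decompose_sub_decompose_mem hJ hx hq h (e - (M + e.natAbs : ℕ))
    (M + e.natAbs) (by omega)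
  rw [hM _ (by rw [← Int.natCast_natAbs]; omega), mul_zero, zero_sub, neg_mem_iff,
    sub_add_cancel] at h'
  exact h'

theorem exists_pow_mul_mem_of_sub_mem (hJ : J.IsHomogeneous 𝒬) {x : Q} (hx : x ∈ 𝒬 1)
    {d : ℤ} {q r : Q} (hq : q ∈ 𝒬 d) (h : (x - 1) * r - q ∈ J) : ∃ N : ℕ, x ^ N * q ∈ J := by
  obtain ⟨M, hM⟩ := exists_forall_decompose_eq_zero 𝒬 r
  refine ⟨M + d.natAbs, ?_⟩
  have h₁ : q + DirectSum.decompose 𝒬 r d ∈ J := by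
    have h' := hJ (1 + (d - 1)) h
    rw [sub_mul, one_mul, DirectSum.decompose_sub, DirectSum.decompose_sub, DirectSum.sub_apply,
      DirectSum.sub_apply, AddSubgroupClass.coe_sub, AddSubgroupClass.coe_sub,
      DirectSum.coe_decompose_mul_add_of_left_mem 𝒬 hx, add_sub_cancel,
      DirectSum.decompose_of_mem_same 𝒬 hq] at h'
    have h'' := Ideal.mul_mem_left J x (decompose_mem_of_lt hJ hx hq h (d - 1) (by omega))
    convert sub_mem h'' h' using 1
    ring
  have h₂ := pow_mul_decompose_sub_decompose_mem hJ hx hq h d (M + d.natAbs) (by omega)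
  rw [hM (d + (M + d.natAbs : ℕ)) (by rw [← Int.natCast_natAbs]; omega), sub_zero] at h₂
  convert sub_mem (Ideal.mul_mem_left J (x ^ (M + d.natAbs)) h₁) h₂ using 1
  ring

theorem mem_of_sub_one_mul_mem (hJ : J.IsHomogeneous 𝒬) {x : Q} (hx : x ∈ 𝒬 1)
    {r : Q} (h : (x - 1) * r ∈ J) : r ∈ J := by
  rw [hJ.mem_iff]
  exact fun e => decompose_mem_of_lt hJ hx (zero_mem (𝒬 (e + 1))) (by rwa [sub_zero]) e
    (lt_add_one e)

theorem exists_sub_mul_mem_of_mem_sup (hJ : J.IsHomogeneous 𝒬) {l g : Q} (hl : l ∈ 𝒬 (-1))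
    (hg : g ∈ 𝒬 0) (h : g ∈ J ⊔ Ideal.span {l}) : ∃ q ∈ 𝒬 1, g - l * q ∈ J := by
  obtain ⟨j, hj, z, hz, rfl⟩ := Submodule.mem_sup.mp h
  obtain ⟨q, rfl⟩ := Ideal.mem_span_singleton.mp hz
  refine ⟨DirectSum.decompose 𝒬 q 1, SetLike.coe_mem _, ?_⟩
  have h₁ := DirectSum.decompose_of_mem_same 𝒬 hg
  have h₂ := hJ 0 hj
  rw [DirectSum.decompose_add, DirectSum.add_apply, AddMemClass.coe_add, ← neg_add_cancel (1 : ℤ),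
    DirectSum.coe_decompose_mul_add_of_left_mem 𝒬 hl, neg_add_cancel] at h₁
  rw [← h₁, add_sub_cancel_right]
  exact h₂

end Graded

/-! ### The blow-up of a Segre cone -/

section SegreCone

open MvPolynomial RingTheory.Sequence

attribute [local instance] MvPolynomial.weightedGradedAlgebra

theorem MvPolynomial.IsHomogeneous.isWeightedHomogeneous_rename {R M σ τ : Type*}
    [CommSemiring R] [AddCommMonoid M] {w : τ → M} {f : σ → τ} {c : M} (hw : ∀ i, w (f i) = c)
    {F : MvPolynomial σ R} {d : ℕ} (hF : F.IsHomogeneous d) :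
    (rename f F).IsWeightedHomogeneous w (d • c) := by
  rw [← F.support_sum_monomial_coeff, map_sum]
  refine IsWeightedHomogeneous.sum _ _ _ fun s hs => ?_
  rw [rename_monomial]
  refine isWeightedHomogeneous_monomial _ _ _ ?_
  rw [Finsupp.weight_apply, Finsupp.sum_mapDomain_index (by simp) (by simp [add_smul]),
    ← hF (mem_support_iff.mp hs), Finsupp.weight_apply]
  simp [Finsupp.sum, hw, Finset.sum_smul]

variable {k : Type u} [Field k] {n m : ℕ}

variable (n m) in
/-- The weights of the variables of `k[x, y]` for which the `xᵢ yⱼ` generate the part of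
weight zero. -/
def segreWeight : Fin (n + 1) ⊕ Fin (m + 1) → ℤ := Sum.elim (fun _ => 1) (fun _ => -1)

theorem weight_segreWeight (s : Fin (n + 1) ⊕ Fin (m + 1) →₀ ℕ) :
    Finsupp.weight (segreWeight n m) s = ∑ i, (s (Sum.inl i) : ℤ) - ∑ j, (s (Sum.inr j) : ℤ) := by
  rw [Finsupp.weight_apply, Finsupp.sum_fintype _ _ (by simp), Fintype.sum_sum_type]
  simp [segreWeight, sub_eq_add_neg]

theorem isWeightedHomogeneous_X_inl (i : Fin (n + 1)) :
    (X (Sum.inl i) : MvPolynomial _ k).IsWeightedHomogeneous (segreWeight n m) 1 :=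
  isWeightedHomogeneous_X k _ _

theorem isWeightedHomogeneous_X_inr (j : Fin (m + 1)) :
    (X (Sum.inr j) : MvPolynomial _ k).IsWeightedHomogeneous (segreWeight n m) (-1) :=
  isWeightedHomogeneous_X k _ _

theorem segreHom_X (ij : Fin (n + 1) × Fin (m + 1)) :
    segreHom k n m (X ij) = X (Sum.inl ij.1) * X (Sum.inr ij.2) :=
  aeval_X _ _

theorem isWeightedHomogeneous_segreHom (F : MvPolynomial (Fin (n + 1) × Fin (m + 1)) k) :
    (segreHom k n m F).IsWeightedHomogeneous (segreWeight n m) 0 := by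
  induction F using MvPolynomial.induction_on with
  | C a =>
    rw [← algebraMap_eq, AlgHom.commutes]
    exact isWeightedHomogeneous_C _ a
  | add p q hp hq => rw [map_add]; exact hp.add hq
  | mul_X p i hp =>
    rw [map_mul, segreHom_X]
    simpa using hp.mul ((isWeightedHomogeneous_X_inl (k := k) (m := m) i.1).mul
      (isWeightedHomogeneous_X_inr (n := n) i.2))

/-- The forms `∑ⱼ bⱼ zᵢⱼ`, which the Segre map takes to `xᵢ ∑ⱼ bⱼ yⱼ`. -/
noncomputable def segreLinearForm (b : Fin (m + 1) → k) (i : Fin (n + 1)) :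
    MvPolynomial (Fin (n + 1) × Fin (m + 1)) k :=
  ∑ j, C (b j) * X (i, j)

theorem segreHom_segreLinearForm (b : Fin (m + 1) → k) (i : Fin (n + 1)) :
    segreHom k n m (segreLinearForm b i) =
      rename Sum.inr (linearForm b) * X (Sum.inl i) := by
  simp only [segreLinearForm, linearForm, segreHom, map_sum, map_mul, aeval_X, algHom_C,
    algebraMap_eq, rename_X, Finset.sum_mul]
  exact Finset.sum_congr rfl fun j _ => by ring

theorem exists_segreHom_eq_pow_mul_monomial (b : Fin (m + 1) → k) (s) (d : ℕ)
    (hs : Finsupp.weight (segreWeight n m) s = d) :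
    ∃ F ∈ Ideal.span (Set.range (segreLinearForm (n := n) b)) ^ d,
      segreHom k n m F = rename Sum.inr (linearForm b) ^ d * monomial s 1 := by
  induction hD : s.degree using Nat.strong_induction_on generalizing s d with
  | _ D ih =>
  subst hD
  by_cases h₁ : ∃ i, s (Sum.inl i) ≠ 0
  · obtain ⟨i, hi⟩ := h₁
    obtain ⟨s, rfl⟩ := le_iff_exists_add.mp
      (Finsupp.single_le_iff.mpr (Nat.one_le_iff_ne_zero.mpr hi))
    by_cases h₂ : ∃ j, (Finsupp.single (Sum.inl i) 1 + s : Fin (n + 1) ⊕ Fin (m + 1) →₀ ℕ) (Sum.inr j) ≠ 0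
    · obtain ⟨j, hj⟩ := h₂
      have hj' : s (Sum.inr j) ≠ 0 := by simpa using hj
      obtain ⟨s, rfl⟩ := le_iff_exists_add.mp
        (Finsupp.single_le_iff.mpr (Nat.one_le_iff_ne_zero.mpr hj'))
      obtain ⟨F, hF, hF'⟩ := ih s.degree (by simp [map_add]; omega) s d (by
        rw [← hs]; simp [map_add, Finsupp.weight_single, segreWeight]) rfl
      refine ⟨X (i, j) * F, Ideal.mul_mem_left _ _ hF, ?_⟩
      rw [map_mul, hF', segreHom_X]
      simp only [monomial_single_add, pow_one]
      ring
    · push Not at h₂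
      have hd : ∑ i', ((Finsupp.single (Sum.inl i) 1 + s : Fin (n + 1) ⊕ Fin (m + 1) →₀ ℕ) (Sum.inl i') : ℤ) = d := by
        rw [← hs, weight_segreWeight]
        simp only [h₂, Nat.cast_zero, Finset.sum_const_zero, sub_zero]
      obtain ⟨d, rfl⟩ : ∃ d', d = d' + 1 := Nat.exists_eq_add_one.mpr (by
        rw [← Nat.cast_pos (α := ℤ), ← hd]
        exact Finset.sum_pos' (fun _ _ => Nat.cast_nonneg _)
          ⟨i, Finset.mem_univ _, by exact_mod_cast Nat.pos_of_ne_zero hi⟩)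
      obtain ⟨F, hF, hF'⟩ := ih s.degree (by simp [map_add]) s d (by
        simp [map_add, Finsupp.weight_single, segreWeight] at hs
        simp [segreWeight]; omega) rfl
      refine ⟨F * segreLinearForm b i, ?_, ?_⟩
      · rw [pow_succ]
        exact Ideal.mul_mem_mul hF (Ideal.subset_span ⟨i, rfl⟩)
      · rw [map_mul, hF', segreHom_segreLinearForm]
        simp only [monomial_single_add, pow_one]
        ring
  · push Not at h₁
    have h₂ : ∑ j, (s (Sum.inr j) : ℤ) + d = 0 := by
      rw [← hs, weight_segreWeight]
      simp [h₁]
    have h₃ : 0 ≤ ∑ j, (s (Sum.inr j) : ℤ) := Finset.sum_nonneg fun _ _ => Nat.cast_nonneg _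
    obtain rfl : d = 0 := by omega
    have h₄ := (Finset.sum_eq_zero_iff_of_nonneg fun j _ => Nat.cast_nonneg (s (Sum.inr j))).mp
      (show ∑ j, (s (Sum.inr j) : ℤ) = 0 by omega)
    obtain rfl : s = 0 := by
      ext (i | j)
      · exact h₁ i
      · exact_mod_cast h₄ j (Finset.mem_univ j)
    exact ⟨1, by simp, by simp⟩

theorem exists_segreHom_eq_pow_mul (b : Fin (m + 1) → k) {d : ℕ}
    {q : MvPolynomial (Fin (n + 1) ⊕ Fin (m + 1)) k}
    (hq : q.IsWeightedHomogeneous (segreWeight n m) d) :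
    ∃ F ∈ Ideal.span (Set.range (segreLinearForm (n := n) b)) ^ d,
      segreHom k n m F = rename Sum.inr (linearForm b) ^ d * q := by
  have h (s : q.support) := exists_segreHom_eq_pow_mul_monomial b s.1 d
    (hq (mem_support_iff.mp s.2))
  choose F hF hF' using h
  refine ⟨∑ s, C (coeff s.1 q) * F s, sum_mem fun s _ => Ideal.mul_mem_left _ _ (hF s), ?_⟩
  conv_rhs => rw [← q.support_sum_monomial_coeff, ← Finset.sum_coe_sort, Finset.mul_sum]
  rw [map_sum]
  refine Finset.sum_congr rfl fun s _ => ?_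
  rw [map_mul, hF', algHom_C, algebraMap_eq, mul_left_comm, C_mul_monomial, mul_one]

theorem exists_isWeightedHomogeneous_sub_one_dvd_sub (i : Fin (n + 1))
    (q : MvPolynomial (Fin (n + 1) ⊕ Fin (m + 1)) k) :
    ∃ D₀ : ℕ, ∀ D : ℕ, D₀ ≤ D → ∃ u : MvPolynomial (Fin (n + 1) ⊕ Fin (m + 1)) k,
      u.IsWeightedHomogeneous (segreWeight n m) D ∧ X (Sum.inl i) - 1 ∣ q - u := by
  induction q using MvPolynomial.induction_on' with
  | monomial s a =>
    refine ⟨(Finsupp.weight (segreWeight n m) s).natAbs, fun D hD => ?_⟩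
    obtain ⟨N, hN⟩ := Int.eq_ofNat_of_zero_le
      (show 0 ≤ D - Finsupp.weight (segreWeight n m) s by omega)
    refine ⟨X (Sum.inl i) ^ N * monomial s a, ?_, ?_⟩
    · have := ((isWeightedHomogeneous_X_inl (k := k) (m := m) i).pow N).mul
        (isWeightedHomogeneous_monomial (segreWeight n m) s a rfl)
      convert this using 1
      simp
      omega
    · have h := sub_dvd_pow_sub_pow (X (Sum.inl i) : MvPolynomial (Fin (n + 1) ⊕ Fin (m + 1)) k)
        1 N
      rw [one_pow] at h
      rw [← dvd_neg, neg_sub, ← sub_one_mul]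
      exact h.mul_right _
  | add p q hp hq =>
    obtain ⟨D₁, h₁⟩ := hp
    obtain ⟨D₂, h₂⟩ := hq
    refine ⟨max D₁ D₂, fun D hD => ?_⟩
    obtain ⟨u, hu, hu'⟩ := h₁ D (le_of_max_le_left hD)
    obtain ⟨v, hv, hv'⟩ := h₂ D (le_of_max_le_right hD)
    refine ⟨u + v, hu.add hv, ?_⟩
    rw [add_sub_add_comm]
    exact dvd_add hu' hv'

variable {fs : List (MvPolynomial (Fin (n + 1)) k)} {gs : List (MvPolynomial (Fin (m + 1)) k)}

theorem isHomogeneous_ofList_rename_append (hfs : ∀ F ∈ fs, ∃ d, F.IsHomogeneous d)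
    (hgs : ∀ G ∈ gs, ∃ d, G.IsHomogeneous d) :
    (Ideal.ofList (fs.map (rename Sum.inl) ++ gs.map (rename Sum.inr))).IsHomogeneous
      (weightedHomogeneousSubmodule k (segreWeight n m)) := by
  refine Ideal.homogeneous_span _ _ fun q hq => ?_
  rcases List.mem_append.mp hq with hq | hq
  · obtain ⟨F, hF, rfl⟩ := List.mem_map.mp hq
    obtain ⟨d, hd⟩ := hfs F hF
    exact ⟨_, hd.isWeightedHomogeneous_rename (w := segreWeight n m) (c := 1) fun _ => rfl⟩
  · obtain ⟨F, hF, rfl⟩ := List.mem_map.mp hq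
    obtain ⟨d, hd⟩ := hgs F hF
    exact ⟨_, hd.isWeightedHomogeneous_rename (w := segreWeight n m) (c := -1) fun _ => rfl⟩

theorem mk_mem_nonZeroDivisors_of_isWeaklyRegular_append {R : Type*} [CommRing R] {rs : List R}
    {r : R} (h : IsWeaklyRegular R (rs ++ [r])) :
    Ideal.Quotient.mk (Ideal.ofList rs) r ∈ nonZeroDivisors (R ⧸ Ideal.ofList rs) := by
  have h' := ((isWeaklyRegular_append_iff_quotient _ _).mp h).2
  rw [List.map_singleton, isWeaklyRegular_singleton_iff] at h'
  exact mem_nonZeroDivisors_iff_right.mpr fun x hx =>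
    h'.right_eq_zero_of_smul (by rwa [smul_eq_mul, mul_comm])

end SegreCone

section SegreConeBlowup

open MvPolynomial RingTheory.Sequence

attribute [local instance] MvPolynomial.weightedGradedAlgebra

variable {k : Type u} [Field k] {n m : ℕ} (b : Fin (m + 1) → k)
  {J : Ideal (MvPolynomial (Fin (n + 1) ⊕ Fin (m + 1)) k)}

theorem isWeightedHomogeneous_rename_linearForm :
    (rename Sum.inr (linearForm b)).IsWeightedHomogeneous (segreWeight n m) (-1) := by
  simpa using (linearForm_isHomogeneous b).isWeightedHomogeneous_rename (w := segreWeight n m)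
    (f := Sum.inr) (c := -1) fun _ => rfl

/-- The inclusion of the coordinate ring of a Segre cone into that of the product of cones. -/
noncomputable def segreQuotientHom (J : Ideal (MvPolynomial (Fin (n + 1) ⊕ Fin (m + 1)) k)) :
    (MvPolynomial (Fin (n + 1) × Fin (m + 1)) k ⧸ J.comap (segreHom k n m)) →+*
      MvPolynomial (Fin (n + 1) ⊕ Fin (m + 1)) k ⧸ J :=
  Ideal.quotientMap J (segreHom k n m : _ →+* _) le_rfl

theorem segreQuotientHom_injective : Function.Injective (segreQuotientHom J) :=
  Ideal.quotientMap_injective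

theorem segreQuotientHom_mk (F : MvPolynomial (Fin (n + 1) × Fin (m + 1)) k) :
    segreQuotientHom J (Ideal.Quotient.mk _ F) = Ideal.Quotient.mk J (segreHom k n m F) :=
  rfl

/-- The ideal of a hyperplane section of a Segre cone. -/
noncomputable def segreHyperplaneIdeal
    (J : Ideal (MvPolynomial (Fin (n + 1) ⊕ Fin (m + 1)) k)) :
    Ideal (MvPolynomial (Fin (n + 1) × Fin (m + 1)) k ⧸ J.comap (segreHom k n m)) :=
  ((J ⊔ Ideal.span {rename Sum.inr (linearForm b)}).comap (segreHom k n m)).map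
    (Ideal.Quotient.mk (J.comap (segreHom k n m)))

theorem span_segreLinearForm_le :
    Ideal.span (Set.range (segreLinearForm (n := n) b)) ≤
      (J ⊔ Ideal.span {rename Sum.inr (linearForm b)}).comap (segreHom k n m) := by
  rw [Ideal.span_le]
  rintro _ ⟨i, rfl⟩
  rw [SetLike.mem_coe, Ideal.mem_comap, segreHom_segreLinearForm]
  exact Ideal.mul_mem_right _ _ (Ideal.mem_sup_right (Ideal.mem_span_singleton_self _))

theorem mk_segreLinearForm_mem (i : Fin (n + 1)) :
    Ideal.Quotient.mk _ (segreLinearForm b i) ∈ segreHyperplaneIdeal b J ^ 1 := by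
  rw [pow_one]
  exact Ideal.mem_map_of_mem _ (span_segreLinearForm_le b (Ideal.subset_span ⟨i, rfl⟩))

theorem exists_mk_eq_of_mem_segreHyperplaneIdeal {a}
    (hJ : J.IsHomogeneous (weightedHomogeneousSubmodule k (segreWeight n m)))
    (ha : a ∈ segreHyperplaneIdeal b J) :
    ∃ q : MvPolynomial _ k, q.IsWeightedHomogeneous (segreWeight n m) 1 ∧
      segreQuotientHom J a =
        Ideal.Quotient.mk J (rename Sum.inr (linearForm b)) * Ideal.Quotient.mk J q := by
  obtain ⟨F, hF, rfl⟩ := (Ideal.mem_map_iff_of_surjective _ Ideal.Quotient.mk_surjective).mp ha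
  obtain ⟨q, hq, hq'⟩ := exists_sub_mul_mem_of_mem_sup hJ
    (isWeightedHomogeneous_rename_linearForm b) (isWeightedHomogeneous_segreHom F) hF
  refine ⟨q, hq, ?_⟩
  rw [segreQuotientHom_mk, ← map_mul]
  exact Ideal.Quotient.eq.mpr hq'

theorem segreHyperplaneIdeal_le_span
    (hJ : J.IsHomogeneous (weightedHomogeneousSubmodule k (segreWeight n m))) :
    segreHyperplaneIdeal b J ≤ Ideal.span (Set.range fun i : Fin (n + 1) =>
      Ideal.Quotient.mk (J.comap (segreHom k n m)) (segreLinearForm b i)) := by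
  intro a ha
  obtain ⟨q, hq, hq'⟩ := exists_mk_eq_of_mem_segreHyperplaneIdeal b hJ ha
  obtain ⟨F, hF, hF'⟩ := exists_segreHom_eq_pow_mul b (d := 1) hq
  rw [pow_one] at hF hF'
  have : a = Ideal.Quotient.mk _ F := segreQuotientHom_injective (by
    rw [hq', segreQuotientHom_mk, hF', map_mul])
  rw [this, Set.range_comp', ← Ideal.map_span]
  exact Ideal.mem_map_of_mem _ hF

theorem exists_mk_eq_of_mem_segreHyperplaneIdeal_pow
    (hJ : J.IsHomogeneous (weightedHomogeneousSubmodule k (segreWeight n m))) (d : ℕ) (a)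
    (ha : a ∈ segreHyperplaneIdeal b J ^ d) :
    ∃ q : MvPolynomial _ k, q.IsWeightedHomogeneous (segreWeight n m) (d : ℤ) ∧
      segreQuotientHom J a =
        Ideal.Quotient.mk J (rename Sum.inr (linearForm b)) ^ d * Ideal.Quotient.mk J q := by
  induction d generalizing a with
  | zero =>
    obtain ⟨F, rfl⟩ := Ideal.Quotient.mk_surjective a
    exact ⟨_, isWeightedHomogeneous_segreHom F, by rw [segreQuotientHom_mk, pow_zero, one_mul]⟩
  | succ d ih =>
    replace ha : a ∈ segreHyperplaneIdeal b J ^ d * segreHyperplaneIdeal b J := by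
      rwa [← Submodule.pow_succ]
    induction ha using Submodule.mul_induction_on' with
    | mem_mul_mem x hx y hy =>
      obtain ⟨q, hq, hq'⟩ := ih x hx
      obtain ⟨r, hr, hr'⟩ := exists_mk_eq_of_mem_segreHyperplaneIdeal b hJ hy
      refine ⟨q * r, by exact_mod_cast hq.mul hr, ?_⟩
      rw [map_mul, hq', hr', map_mul]
      ring
    | add x hx y hy hx' hy' =>
      obtain ⟨q, hq, hq'⟩ := hx'
      obtain ⟨r, hr, hr'⟩ := hy'
      exact ⟨q + r, hq.add hr, by rw [map_add, hq', hr', map_add, mul_add]⟩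

theorem exists_mem_segreHyperplaneIdeal_pow {d : ℕ} {q : MvPolynomial _ k}
    (hq : q.IsWeightedHomogeneous (segreWeight n m) (d : ℤ)) :
    ∃ a ∈ segreHyperplaneIdeal b J ^ d, segreQuotientHom J a =
      Ideal.Quotient.mk J (rename Sum.inr (linearForm b)) ^ d * Ideal.Quotient.mk J q := by
  obtain ⟨F, hF, hF'⟩ := exists_segreHom_eq_pow_mul b hq
  refine ⟨Ideal.Quotient.mk _ F, ?_, by rw [segreQuotientHom_mk, hF', map_mul, map_pow]⟩
  rw [segreHyperplaneIdeal, ← Ideal.map_pow]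
  exact Ideal.mem_map_of_mem _ (Ideal.pow_right_mono (span_segreLinearForm_le b) d hF)

theorem nonempty_segreChart_ringEquiv
    (hJ : J.IsHomogeneous (weightedHomogeneousSubmodule k (segreWeight n m)))
    (hl : Ideal.Quotient.mk J (rename Sum.inr (linearForm b)) ∈ nonZeroDivisors _)
    (i : Fin (n + 1)) :
    Nonempty (HomogeneousLocalization.Away (reesGrading (segreHyperplaneIdeal b J))
      (reesMonomial _ 1 _ (mk_segreLinearForm_mem b i)) ≃+*
        (MvPolynomial _ k ⧸ J) ⧸ Ideal.span {Ideal.Quotient.mk J (X (Sum.inl i)) - 1}) := by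
  refine nonempty_reesAway_ringEquiv segreQuotientHom_injective hl
    (fun d => Ideal.Quotient.mk J '' {q | q.IsWeightedHomogeneous (segreWeight n m) (d : ℤ)})
    (fun d a ha => ?_) ?_ ?_ (fun y => ?_) _ _ ?_
  · obtain ⟨q, hq, h⟩ := exists_mk_eq_of_mem_segreHyperplaneIdeal_pow b hJ d a ha
    exact ⟨_, ⟨q, hq, rfl⟩, h⟩
  · rintro d _ ⟨q, hq, rfl⟩
    exact exists_mem_segreHyperplaneIdeal_pow b hq
  · rintro d _ ⟨q, hq, rfl⟩ ⟨r, hr⟩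
    obtain ⟨r, rfl⟩ := Ideal.Quotient.mk_surjective r
    rw [← map_one (Ideal.Quotient.mk J), ← map_sub, ← map_mul] at hr
    obtain ⟨N, hN⟩ := exists_pow_mul_mem_of_sub_mem hJ
      (isWeightedHomogeneous_X_inl (k := k) (m := m) i) hq (Ideal.Quotient.eq.mp hr.symm)
    exact ⟨N, by rwa [← map_pow, ← map_mul, Ideal.Quotient.eq_zero_iff_mem]⟩
  · obtain ⟨y, rfl⟩ := Ideal.Quotient.mk_surjective y
    obtain ⟨D, hD⟩ := exists_isWeightedHomogeneous_sub_one_dvd_sub i y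
    obtain ⟨u, hu, hu'⟩ := hD D le_rfl
    refine ⟨D, _, ⟨u, hu, rfl⟩, ?_⟩
    simpa using map_dvd (Ideal.Quotient.mk J) hu'
  · rw [segreQuotientHom_mk, segreHom_segreLinearForm, map_mul]

theorem isGorensteinScheme_affineBlowup_segreHyperplaneIdeal
    (hJ : J.IsHomogeneous (weightedHomogeneousSubmodule k (segreWeight n m)))
    (hl : Ideal.Quotient.mk J (rename Sum.inr (linearForm b)) ∈ nonZeroDivisors _)
    (hd : ∃ d, HasInjectiveDimensionLE
      (ModuleCat.of (MvPolynomial _ k ⧸ J) (MvPolynomial _ k ⧸ J)) d) :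
    IsGorensteinScheme (affineBlowup (segreHyperplaneIdeal b J)) := by
  refine isGorensteinScheme_affineBlowup _ (mk_segreLinearForm_mem b)
    (segreHyperplaneIdeal_le_span b hJ)
    (fun i => (MvPolynomial (Fin (n + 1) ⊕ Fin (m + 1)) k ⧸ J) ⧸
      Ideal.span {Ideal.Quotient.mk J (X (Sum.inl i)) - 1})
    (fun i => exists_hasInjectiveDimensionLE_quotient_span_singleton ?_ hd)
    (nonempty_segreChart_ringEquiv b hJ hl)
  rw [mem_nonZeroDivisors_iff_right]
  intro y hy
  obtain ⟨y, rfl⟩ := Ideal.Quotient.mk_surjective y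
  rw [← map_one (Ideal.Quotient.mk _), ← map_sub, ← map_mul, Ideal.Quotient.eq_zero_iff_mem,
    mul_comm] at hy
  exact Ideal.Quotient.eq_zero_iff_mem.mpr
    (mem_of_sub_one_mul_mem hJ (isWeightedHomogeneous_X_inl (k := k) (m := m) i) hy)

/-- The blow-up of the Segre cone over the product of two complete intersections along a
hyperplane section of the second factor is Gorenstein. -/
theorem isGorensteinScheme_affineBlowup_segreHyperplaneIdeal_of_isWeaklyRegular
    {fs : List (MvPolynomial (Fin (n + 1)) k)} {gs : List (MvPolynomial (Fin (m + 1)) k)}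
    (hfs : ∀ F ∈ fs, ∃ d, F.IsHomogeneous d) (hgs : ∀ G ∈ gs, ∃ d, G.IsHomogeneous d)
    (hfs' : IsWeaklyRegular (MvPolynomial (Fin (n + 1)) k) fs)
    (hgs' : IsWeaklyRegular (MvPolynomial (Fin (m + 1)) k) (gs ++ [linearForm b]))
    (hJ : J = Ideal.ofList (fs.map (rename Sum.inl) ++ gs.map (rename Sum.inr))) :
    IsGorensteinScheme (affineBlowup (segreHyperplaneIdeal b J)) := by
  subst hJ
  have hreg := isWeaklyRegular_rename_append fs _ hfs' hgs'
  rw [List.map_append, List.map_singleton, ← List.append_assoc] at hreg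
  exact isGorensteinScheme_affineBlowup_segreHyperplaneIdeal b
    (isHomogeneous_ofList_rename_append hfs hgs)
    (mk_mem_nonZeroDivisors_of_isWeaklyRegular_append hreg)
    (exists_hasInjectiveDimensionLE_quotient_ofList _
      ((isWeaklyRegular_append_iff_quotient _ _).mp hreg).1
      (MvPolynomial.exists_hasInjectiveDimensionLE_self k _))

end SegreConeBlowup

/-! ### Homogeneous ideals of subschemes of projective space -/

section ProjBasicOpen

open HomogeneousLocalization

variable {σ A : Type*} [CommRing A] [SetLike σ A] [AddSubgroupClass σ A] (𝒜 : ℕ → σ)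
  [GradedRing 𝒜] {f : A} {d : ℕ}

theorem isUnit_mapId_awayMk_iff (hf : f ∈ 𝒜 d) (n : ℕ) (F : A) (hF : F ∈ 𝒜 (n • d))
    (x : ProjectiveSpectrum 𝒜)
    (hx : Submonoid.powers f ≤ x.asHomogeneousIdeal.toIdeal.primeCompl) :
    IsUnit (HomogeneousLocalization.mapId 𝒜 hx (Away.mk 𝒜 hf n F hF)) ↔ F ∉ x.asHomogeneousIdeal := by
  have hv : (HomogeneousLocalization.mapId 𝒜 hx (Away.mk 𝒜 hf n F hF)).val =
      Localization.mk F ⟨f ^ n, hx ⟨n, rfl⟩⟩ := rfl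
  rw [← isUnit_iff_isUnit_val, hv, Localization.mk_eq_mk', IsLocalization.AtPrime.isUnit_mk'_iff]
  rfl

theorem mem_basicOpen_awayToSection (hf : f ∈ 𝒜 d) (n : ℕ) (F : A)
    (hF : F ∈ 𝒜 (n • d)) (x : Proj 𝒜) (hx : x ∈ Proj.basicOpen 𝒜 f) :
    x ∈ (Proj 𝒜).basicOpen ((Proj.awayToSection 𝒜 f).hom (Away.mk 𝒜 hf n F hF)) ↔
      F ∉ ProjectiveSpectrum.asHomogeneousIdeal (𝒜 := 𝒜) x := by
  rw [Scheme.mem_basicOpen _ _ x hx]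
  have h : ((Proj 𝒜).presheaf.germ _ x hx).hom
      ((Proj.awayToSection 𝒜 f).hom (Away.mk 𝒜 hf n F hF)) =
      (Proj.stalkIso' 𝒜 x).symm (HomogeneousLocalization.mapId 𝒜 (Submonoid.powers_le.mpr hx)
        (Away.mk 𝒜 hf n F hF)) :=
    congrArg (fun φ => φ.hom (Away.mk 𝒜 hf n F hF))
      (ProjectiveSpectrum.Proj.awayToSection_germ (𝒜 := 𝒜) f x hx)
  refine (iff_of_eq (congrArg IsUnit h)).trans ((MulEquiv.isUnit_map _).trans
    (isUnit_mapId_awayMk_iff 𝒜 hf n F hF x _))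

end ProjBasicOpen

theorem Localization.mk_sub_mk_mul_mk_powers {R : Type*} [CommRing R] (x F G L : R) (d e c : ℕ) :
    Localization.mk F (⟨x ^ d, d, rfl⟩ : Submonoid.powers x) - Localization.mk G (⟨x ^ e, e, rfl⟩ : Submonoid.powers x) *
      Localization.mk L (⟨x ^ c, c, rfl⟩ : Submonoid.powers x) =
      (Localization.mk (x ^ (e + c) * F - x ^ d * (G * L)) ⟨x ^ (d + e + c), d + e + c, rfl⟩ :
        Localization (Submonoid.powers x)) := by
  rw [Localization.mk_mul]
  simp only [Localization.mk_eq_mk']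
  rw [← IsLocalization.mk'_sub, IsLocalization.mk'_eq_iff_eq]
  simp only [Submonoid.coe_mul]
  congr 1
  ring

section ProjSubscheme

open MvPolynomial

attribute [local instance] MvPolynomial.gradedAlgebra

variable {k : Type u} [Field k] {n : ℕ} {T : Scheme.{u}}

/-- The ring homomorphism that takes `F / xⱼᵈ` to its restriction to `T`. -/
noncomputable def restrictAway (i : T ⟶ projSpace k n) (j : Fin (n + 1)) :
    HomogeneousLocalization.Away (homogeneousSubmodule (Fin (n + 1)) k) (X j) →+*
      Γ(T, i ⁻¹ᵁ projChart j) :=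
  (i.app (projChart j)).hom.comp (Proj.awayToSection _ (X j)).hom

theorem restrictAway_surjective (i : T ⟶ projSpace k n) [IsClosedImmersion i] (j : Fin (n + 1)) :
    Function.Surjective (restrictAway i j) := by
  have hX : (X j : MvPolynomial (Fin (n + 1)) k) ∈ homogeneousSubmodule (Fin (n + 1)) k 1 :=
    isHomogeneous_X k j
  refine (i.app_surjective _ (Proj.isAffineOpen_basicOpen _ _ hX one_pos)).comp ?_
  exact (Proj.basicOpenIsoAway _ _ hX one_pos).commRingCatIsoToRingEquiv.surjective

/-- The element `F / xⱼᵈ` of `k[x₀, …, xₙ]_{(xⱼ)}`. -/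
noncomputable def awayForm {d : ℕ} (F : MvPolynomial (Fin (n + 1)) k) (hF : F.IsHomogeneous d)
    (j : Fin (n + 1)) :
    HomogeneousLocalization.Away (homogeneousSubmodule (Fin (n + 1)) k) (X j) :=
  HomogeneousLocalization.Away.mk (homogeneousSubmodule (Fin (n + 1)) k)
    ((mem_homogeneousSubmodule 1 _).mpr (isHomogeneous_X k j)) d F
    ((mem_homogeneousSubmodule _ _).mpr (by rwa [smul_eq_mul, mul_one]))

theorem awayForm_surjective (j : Fin (n + 1))
    (z : HomogeneousLocalization.Away (homogeneousSubmodule (Fin (n + 1)) k) (X j)) :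
    ∃ (d : ℕ) (F : MvPolynomial (Fin (n + 1)) k) (hF : F.IsHomogeneous d), awayForm F hF j = z := by
  obtain ⟨d, F, hF, rfl⟩ := HomogeneousLocalization.Away.mk_surjective
    (homogeneousSubmodule (Fin (n + 1)) k)
    ((mem_homogeneousSubmodule 1 _).mpr (isHomogeneous_X k j)) z
  exact ⟨d, F, by rwa [smul_eq_mul, mul_one] at hF, rfl⟩

theorem awayForm_sub_mul {d e c : ℕ} {F G L : MvPolynomial (Fin (n + 1)) k}
    (hF : F.IsHomogeneous d) (hG : G.IsHomogeneous e) (hL : L.IsHomogeneous c) (j : Fin (n + 1)) :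
    ∃ h : (X j ^ (e + c) * F - X j ^ d * (G * L)).IsHomogeneous (d + e + c),
      awayForm F hF j - awayForm G hG j * awayForm L hL j = awayForm _ h j := by
  refine ⟨?_, ?_⟩
  · refine IsHomogeneous.sub ?_ ?_
    · have := ((isHomogeneous_X k j).pow (e + c)).mul hF
      rwa [one_mul, add_comm (e + c) d, ← add_assoc] at this
    · have := ((isHomogeneous_X k j).pow d).mul (hG.mul hL)
      rwa [one_mul, ← add_assoc] at this
  · apply HomogeneousLocalization.val_injective
    rw [HomogeneousLocalization.val_sub, HomogeneousLocalization.val_mul]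
    simp only [awayForm, HomogeneousLocalization.Away.val_mk]
    exact Localization.mk_sub_mk_mul_mk_powers (X j) F G L d e c

variable [IsIntegral T] (i : T ⟶ projSpace k n)

/-- The homogeneous prime ideal of the generic point of `T`. -/
noncomputable def genericIdeal : Ideal (MvPolynomial (Fin (n + 1)) k) :=
  (ProjectiveSpectrum.asHomogeneousIdeal (𝒜 := homogeneousSubmodule (Fin (n + 1)) k)
    (i (genericPoint T))).toIdeal

instance : (genericIdeal i).IsPrime :=
  (ProjectiveSpectrum.isPrime (𝒜 := homogeneousSubmodule (Fin (n + 1)) k)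
    (i (genericPoint T)))

theorem exists_X_notMem (x : projSpace k n) : ∃ j : Fin (n + 1), X j ∉
    ProjectiveSpectrum.asHomogeneousIdeal (𝒜 := homogeneousSubmodule (Fin (n + 1)) k) x := by
  by_contra! h
  refine ProjectiveSpectrum.not_irrelevant_le (𝒜 := homogeneousSubmodule (Fin (n + 1)) k) x
    ((HomogeneousIdeal.irrelevant_le _).mpr fun d hd F hF => ?_)
  have hF' : F ∈ Ideal.span (X '' Set.univ) := mem_ideal_span_X_image.mpr fun s hs => by
    by_contra! hs'
    obtain rfl : s = 0 := Finsupp.ext fun j => hs' j (Set.mem_univ j)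
    exact hd.ne (by simpa using hF (mem_support_iff.mp hs))
  refine Ideal.span_le.mpr ?_ hF'
  rintro _ ⟨j, -, rfl⟩
  exact h j

theorem restrictForm_eq_zero_iff {d : ℕ} {F : MvPolynomial (Fin (n + 1)) k}
    (hF : F.IsHomogeneous d) (j : Fin (n + 1)) :
    restrictForm i F hF j = 0 ↔ X j ∈ genericIdeal i ∨ F ∈ genericIdeal i := by
  have h₀ : restrictForm i F hF j = 0 ↔ genericPoint T ∉ T.basicOpen (restrictForm i F hF j) := by
    rw [← basicOpen_eq_bot_iff, ← SetLike.mem_coe, ((genericPoint_spec T).mem_open_set_iff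
      (T.basicOpen (restrictForm i F hF j)).isOpen), Set.univ_inter,
      Set.not_nonempty_iff_eq_empty, TopologicalSpace.Opens.coe_eq_empty]
  rw [h₀]
  by_cases hj : X j ∈ genericIdeal i
  · simp only [hj, true_or, iff_true]
    exact fun h => (T.basicOpen_le _ h : i (genericPoint T) ∈ projChart j) hj
  · rw [restrictForm, ← Scheme.preimage_basicOpen]
    have := mem_basicOpen_awayToSection (homogeneousSubmodule (Fin (n + 1)) k)
      ((mem_homogeneousSubmodule 1 _).mpr (isHomogeneous_X k j)) d F
      ((mem_homogeneousSubmodule _ _).mpr (by rwa [smul_eq_mul, mul_one])) (i (genericPoint T)) hj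
    simp only [hj, false_or]
    exact (not_congr this).trans not_not

theorem homogeneousIdealOf_eq_genericIdeal : homogeneousIdealOf i = genericIdeal i := by
  apply le_antisymm
  · refine Ideal.span_le.mpr ?_
    rintro F ⟨d, hF, h⟩
    obtain ⟨j, hj⟩ := exists_X_notMem (i (genericPoint T))
    exact ((restrictForm_eq_zero_iff i hF j).mp (h j)).resolve_left hj
  · intro F hF
    rw [← sum_homogeneousComponent F]
    refine sum_mem fun d _ => Ideal.subset_span ⟨d, homogeneousComponent_isHomogeneous d F,
      fun j => (restrictForm_eq_zero_iff i _ j).mpr (Or.inr ?_)⟩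
    exact homogeneousComponent_mem_of_mem (ProjectiveSpectrum.asHomogeneousIdeal
      (𝒜 := homogeneousSubmodule (Fin (n + 1)) k) (i (genericPoint T))).isHomogeneous hF d

theorem length_add_one_le_of_homogeneousIdealOf_eq [IsClosedImmersion i]
    (hT : 0 < topologicalKrullDim T) {gs : List (MvPolynomial (Fin (n + 1)) k)}
    (hgs : RingTheory.Sequence.IsWeaklyRegular (MvPolynomial (Fin (n + 1)) k) gs)
    (h : homogeneousIdealOf i = Ideal.ofList gs) : gs.length + 1 ≤ n := by
  obtain ⟨Z₁, Z₂, hZ⟩ := Order.krullDim_pos_iff.mp hT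
  obtain ⟨w, hw⟩ := QuasiSober.sober Z₁.isIrreducible Z₁.isClosed
  have hne : i (genericPoint T) ≠ i w := fun he => by
    rw [← i.isClosedEmbedding.injective he] at hw
    refine hZ.not_ge fun x _ => ?_
    have : x ∈ closure {genericPoint T} := (genericPoint_specializes x).mem_closure
    rwa [hw.def] at this
  have hle := (ProjectiveSpectrum.le_iff_mem_closure
    (𝒜 := homogeneousSubmodule (Fin (n + 1)) k) (i (genericPoint T)) (i w)).mpr
    ((genericPoint_specializes w).map i.continuous).mem_closure
  let P : PrimeSpectrum (MvPolynomial (Fin (n + 1)) k) := ⟨genericIdeal i, inferInstance⟩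
  let Q : PrimeSpectrum (MvPolynomial (Fin (n + 1)) k) :=
    ⟨(ProjectiveSpectrum.asHomogeneousIdeal (𝒜 := homogeneousSubmodule (Fin (n + 1)) k)
      (i w)).toIdeal, ProjectiveSpectrum.isPrime (𝒜 := homogeneousSubmodule (Fin (n + 1)) k) (i w)⟩
  let M : PrimeSpectrum (MvPolynomial (Fin (n + 1)) k) :=
    ⟨RingHom.ker (constantCoeff (R := k) (σ := Fin (n + 1))), RingHom.ker_isPrime _⟩
  have hPQ : P < Q := by
    refine lt_of_le_of_ne hle fun he => hne ?_
    exact ProjectiveSpectrum.ext (HomogeneousIdeal.toIdeal_injective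
      (congrArg PrimeSpectrum.asIdeal he))
  have hQM : Q < M := by
    refine lt_of_le_of_ne (fun F hF => ?_) fun he => ?_
    · have h₀ := homogeneousComponent_mem_of_mem (ProjectiveSpectrum.asHomogeneousIdeal
        (𝒜 := homogeneousSubmodule (Fin (n + 1)) k) (i w)).isHomogeneous hF 0
      rw [homogeneousComponent_zero] at h₀
      by_contra hF'
      exact Q.isPrime.ne_top (Ideal.eq_top_of_isUnit_mem _ h₀
        ((isUnit_iff_ne_zero.mpr hF').map C))
    · obtain ⟨j, hj⟩ := exists_X_notMem (i w)
      refine hj ?_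
      have : X j ∈ M.asIdeal := constantCoeff_X _ _
      rwa [← he] at this
  have := length_add_two_le_of_isWeaklyRegular gs hgs P Q M hPQ hQM
    (h.symm.trans (homogeneousIdealOf_eq_genericIdeal i)).le
  omega

end ProjSubscheme

section HyperplaneSection

open MvPolynomial RingTheory.Sequence

attribute [local instance] MvPolynomial.gradedAlgebra

variable {k : Type u} [Field k] {n : ℕ} {W H : Scheme.{u}} [IsIntegral W]
  {iW : W ⟶ projSpace k n} {iH : H ⟶ W} {b : Fin (n + 1) → k}
  {gs : List (MvPolynomial (Fin (n + 1)) k)}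

theorem isWeaklyRegular_append_of_notMem_homogeneousIdealOf
    (hgs : IsWeaklyRegular (MvPolynomial (Fin (n + 1)) k) gs)
    (h : homogeneousIdealOf iW = Ideal.ofList gs) {l : MvPolynomial (Fin (n + 1)) k}
    (hl : l ∉ homogeneousIdealOf iW) :
    IsWeaklyRegular (MvPolynomial (Fin (n + 1)) k) (gs ++ [l]) := by
  rw [isWeaklyRegular_append_iff_quotient, List.map_singleton, isWeaklyRegular_singleton_iff]
  have : (Ideal.ofList gs).IsPrime := by
    rw [← h, homogeneousIdealOf_eq_genericIdeal]
    infer_instance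
  refine ⟨hgs, fun x y hxy => mul_left_cancel₀ ?_ hxy⟩
  rwa [Ideal.Quotient.algebraMap_eq, Ne, Ideal.Quotient.eq_zero_iff_mem, ← h]

theorem homogeneousIdealOf_comp_eq [IsClosedImmersion iW] (hH : IsHyperplaneSection iW iH b)
    (hW : 0 < topologicalKrullDim W)
    (hgs : IsWeaklyRegular (MvPolynomial (Fin (n + 1)) k) gs)
    (h : homogeneousIdealOf iW = Ideal.ofList gs) :
    homogeneousIdealOf (iH ≫ iW) = homogeneousIdealOf iW ⊔ Ideal.span {linearForm b} := by
  have hcomp {d : ℕ} (F : MvPolynomial (Fin (n + 1)) k) (hF : F.IsHomogeneous d)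
      (j : Fin (n + 1)) : restrictForm (iH ≫ iW) F hF j = 0 ↔
        restrictForm iW F hF j ∈ RingHom.ker (iH.app (iW ⁻¹ᵁ projChart j)).hom := by
    rw [restrictForm, Scheme.Hom.comp_app]
    rfl
  apply le_antisymm
  · refine Ideal.span_le.mpr ?_
    rintro F ⟨d, hF, hF'⟩
    have hlist : homogeneousIdealOf iW ⊔ Ideal.span {linearForm b} =
        Ideal.ofList (gs ++ [linearForm b]) := by
      rw [Ideal.ofList_append, Ideal.ofList_singleton, h]
    have hlen := length_add_one_le_of_homogeneousIdealOf_eq iW hW hgs h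
    rw [SetLike.mem_coe, hlist]
    refine mem_ofList_of_forall_exists_X_pow_mul_mem _
      (isWeaklyRegular_append_of_notMem_homogeneousIdealOf hgs h hH.notMem)
      (by rw [List.length_append, List.length_singleton]; omega) F fun j => ?_
    rw [← hlist, homogeneousIdealOf_eq_genericIdeal]
    have hker := (hcomp F hF j).mp (hF' j)
    rw [hH.ker_eq, Ideal.mem_span_singleton'] at hker
    obtain ⟨c, hc⟩ := hker
    obtain ⟨g, rfl⟩ := restrictAway_surjective iW j c
    obtain ⟨e, G, hG, rfl⟩ := awayForm_surjective j g
    obtain ⟨hK, hK'⟩ := awayForm_sub_mul hF hG (linearForm_isHomogeneous b) j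
    have h₀ : restrictForm iW _ hK j = 0 := by
      refine (congrArg (restrictAway iW j) hK').symm.trans ((map_sub _ _ _).trans ?_)
      exact sub_eq_zero.mpr (hc.symm.trans (map_mul _ _ _).symm)
    rcases (restrictForm_eq_zero_iff iW hK j).mp h₀ with h₁ | h₁
    · exact ⟨1, Ideal.mem_sup_left (Ideal.mul_mem_right _ _ (by rwa [pow_one]))⟩
    · refine ⟨e + 1, ?_⟩
      rw [← sub_add_cancel (X j ^ (e + 1) * F) (X j ^ d * (G * linearForm b))]
      refine add_mem (Ideal.mem_sup_left h₁) (Ideal.mem_sup_right ?_)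
      exact Ideal.mul_mem_left _ _ (Ideal.mul_mem_left _ _ (Ideal.mem_span_singleton_self _))
  · refine sup_le (Ideal.span_mono ?_) (Ideal.span_le.mpr (Set.singleton_subset_iff.mpr ?_))
    · rintro F ⟨d, hF, hF'⟩
      exact ⟨d, hF, fun j => (hcomp F hF j).mpr (by rw [hF' j]; exact zero_mem _)⟩
    · refine Ideal.subset_span ⟨1, linearForm_isHomogeneous b, fun j => ?_⟩
      rw [hcomp, hH.ker_eq]
      exact Ideal.mem_span_singleton_self _

end HyperplaneSection

/-- Let `V ⊆ ℙⁿ` and `W ⊆ ℙᵐ` be positive dimensional normal complete intersection varieties over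
an algebraically closed field, and let `H ⊆ W` be such that `{p} × H` is a hyperplane section of
`{p} × W` for a closed point `p` of `V`. Then the blow-up of the affine cone `C(V × W)` along
`C(V × H)` is Gorenstein. -/
theorem blowup_of_cone_Gorenstein_of_complete_intersections
    {k : Type u} [Field k] [IsAlgClosed k] {n m : ℕ}
    {V W H : Scheme.{u}} (iV : V ⟶ projSpace k n) (iW : W ⟶ projSpace k m) (iH : H ⟶ W)
    [IsClosedImmersion iV] [IsIntegral V] (hVnormal : IsNormalScheme V)
    (hVci : IsCompleteIntersection iV) (hVdim : 0 < topologicalKrullDim V)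
    [IsClosedImmersion iW] [IsIntegral W] (hWnormal : IsNormalScheme W)
    (hWci : IsCompleteIntersection iW) (hWdim : 0 < topologicalKrullDim W)
    (p : V) (hp : IsClosed ({p} : Set V)) (hH : IsHyperplaneSectionAt iV iW iH p) :
    IsGorensteinScheme (segreConeBlowup iV iW iH) := by
  obtain ⟨fs, hfs, hfs', hV⟩ := hVci
  obtain ⟨gs, hgs, hgs', hW⟩ := hWci
  obtain ⟨a, c, -, hH⟩ := hH
  have hI := homogeneousIdealOf_comp_eq hH hWdim hgs'.toIsWeaklyRegular hW
  have hl := isWeaklyRegular_append_of_notMem_homogeneousIdealOf hgs'.toIsWeaklyRegular hW hH.notMem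
  have hZ : segreIdeal iV (iH ≫ iW) =
      (((homogeneousIdealOf iV).map (MvPolynomial.rename (R := k) Sum.inl) ⊔
        (homogeneousIdealOf iW).map (MvPolynomial.rename (R := k) Sum.inr)) ⊔
        Ideal.span {MvPolynomial.rename Sum.inr (linearForm fun j => ∑ i, c i j * a i)}).comap
        (segreHom k n m) := by
    rw [segreIdeal, hI, Ideal.map_sup, ← sup_assoc, Ideal.map_span, Set.image_singleton]
  rw [segreConeBlowup, segreConeIdeal, hZ]
  refine isGorensteinScheme_affineBlowup_segreHyperplaneIdeal_of_isWeaklyRegular _ hfs hgs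
    hfs'.toIsWeaklyRegular hl ?_
  rw [hV, hW, Ideal.ofList_append]
  exact congrArg₂ _ (Ideal.map_ofList (MvPolynomial.rename (R := k) Sum.inl).toRingHom fs)
    (Ideal.map_ofList (MvPolynomial.rename (R := k) Sum.inr).toRingHom gs)
end

section
/- Let $k$ be an algebraically closed field and let $V\subseteq\mathbb P^n_k$ be a smooth projective variety of positive dimension. Embed $\mathbb P^n\times\mathbb P^1$ in $\mathbb P^N$, $N=2n+1$, by the Segre embedding $([x],[y])\mapsto[x_iy_j]$. For a closed subvariety $T\subseteq\mathbb P^N$ with homogeneous ideal $I(T)\subseteq k[z_{ij}\mid 0\le i\le n,\ 0\le j\le 1]$, let $C(T)=\operatorname{Spec} k[z_{ij}]/I(T)\subseteq\mathbb A^{N+1}$ be the affine cone over $T$; its vertex is the origin of $\mathbb A^{N+1}$. Put $Y=C(V\times\mathbb P^1)$ with vertex $v$, and let $H,H'\in\mathbb P^1$ be two distinct closed points. Then the scheme-theoretic intersection of the closed subschemes $C(V\times\{H\})$ and $C(V\times\{H'\})$ of $Y$, i.e. the fibre product $C(V\times\{H\})\times_Y C(V\times\{H'\})$, is the single reduced point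 $v$: it is $\operatorname{Spec} k$, embedded in $Y$ as the vertex. -/
open CategoryTheory AlgebraicGeometry

universe u

namespace SegreCone

noncomputable section

/-- Projective space over `k` with homogeneous coordinates indexed by `ι`, as the set of its
closed points (for `k` algebraically closed). Thus `ℙⁿ` is `ProjSpace k (Fin (n + 1))`. -/
def ProjSpace (k : Type u) [Field k] (ι : Type) : Type u :=
  Projectivization k (ι → k)

variable {k : Type u} [Field k] {ι κ : Type}

/-- The polynomial `f` vanishes at `p`, i.e. at all vectors of homogeneous coordinates of `p`. -/
def VanishesAt (f : MvPolynomial ι k) (p : ProjSpace k ι) : Prop :=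
  ∀ (x : ι → k) (hx : x ≠ 0), Projectivization.mk k x hx = p → MvPolynomial.eval x f = 0

/-- The Zariski topology on projective space: the sets where a homogeneous polynomial does
not vanish form a basis of open sets. -/
instance zariskiTopology : TopologicalSpace (ProjSpace k ι) :=
  TopologicalSpace.generateFrom
    {U | ∃ (f : MvPolynomial ι k) (d : ℕ), f.IsHomogeneous d ∧ U = {p | ¬ VanishesAt f p}}

/-- The homogeneous ideal `I(T)`, generated by the homogeneous polynomials vanishing on `T`. -/
def homogIdeal (T : Set (ProjSpace k ι)) : Ideal (MvPolynomial ι k) :=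
  Ideal.span {f | (∃ d, f.IsHomogeneous d) ∧ ∀ p ∈ T, VanishesAt f p}

/-- The coordinate ring `k[x] / (I(T), xᵢ - 1)` of the affine chart `T ∩ {xᵢ ≠ 0}` of `T`. -/
abbrev ChartRing (T : Set (ProjSpace k ι)) (i : ι) : Type u :=
  MvPolynomial ι k ⧸ (homogIdeal T ⊔ Ideal.span {MvPolynomial.X i - 1})

/-- `T` is a smooth projective variety: irreducible, Zariski closed, and smooth over `k`
on each of its standard affine charts. -/
structure IsSmoothProjectiveVariety (T : Set (ProjSpace k ι)) : Prop where
  isClosed : IsClosed T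
  isIrreducible : IsIrreducible T
  smooth : ∀ i : ι, Algebra.Smooth k (ChartRing T i)

theorem segre_ne_zero {x : ι → k} {y : κ → k} (hx : x ≠ 0) (hy : y ≠ 0) :
    (fun ij : ι × κ => x ij.1 * y ij.2) ≠ 0 := by
  obtain ⟨i, hi⟩ := Function.ne_iff.mp hx
  obtain ⟨j, hj⟩ := Function.ne_iff.mp hy
  exact Function.ne_iff.mpr ⟨(i, j), mul_ne_zero hi hj⟩

/-- The Segre embedding `([x], [y]) ↦ [z]`, `z_{ij} = xᵢ yⱼ`. -/
def segre (p : ProjSpace k ι) (q : ProjSpace k κ) : ProjSpace k (ι × κ) :=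
  Projectivization.mk k (fun ij => Projectivization.rep p ij.1 * Projectivization.rep q ij.2)
    (segre_ne_zero (Projectivization.rep_nonzero p) (Projectivization.rep_nonzero q))

/-- The Segre embedding does not depend on the choice of homogeneous coordinates. -/
theorem segre_mk (x : ι → k) (hx : x ≠ 0) (y : κ → k) (hy : y ≠ 0) :
    segre (Projectivization.mk k x hx) (Projectivization.mk k y hy) =
      Projectivization.mk k (fun ij => x ij.1 * y ij.2) (segre_ne_zero hx hy) := by
  obtain ⟨a, ha⟩ := Projectivization.exists_smul_eq_mk_rep k x hx
  obtain ⟨b, hb⟩ := Projectivization.exists_smul_eq_mk_rep k y hy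
  refine (Projectivization.mk_eq_mk_iff k _ _ _ _).mpr ⟨a * b, ?_⟩
  funext ij
  rw [← ha, ← hb]
  simp only [Pi.smul_apply, Units.smul_def, Units.val_mul, smul_eq_mul]
  ring

/-- `V × W` as a subset of the projective space of the Segre embedding. -/
def segreProd (V : Set (ProjSpace k ι)) (W : Set (ProjSpace k κ)) :
    Set (ProjSpace k (ι × κ)) :=
  Set.image2 segre V W

/-- The affine cone `C(T)`, the closed subscheme of affine space (with coordinates indexed by
`ι`) defined by the homogeneous ideal of `T`. -/
def cone (T : Set (ProjSpace k ι)) : Scheme.{u} :=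
  Spec (CommRingCat.of (MvPolynomial ι k ⧸ homogIdeal T))

theorem homogIdeal_anti {S T : Set (ProjSpace k ι)} (h : S ⊆ T) :
    homogIdeal T ≤ homogIdeal S :=
  Ideal.span_mono fun _ hf => ⟨hf.1, fun p hp => hf.2 p (h hp)⟩

/-- The inclusion `C(S) ⊆ C(T)` of cones for `S ⊆ T`. -/
def coneInclusion {S T : Set (ProjSpace k ι)} (h : S ⊆ T) : cone S ⟶ cone T :=
  Spec.map (CommRingCat.ofHom (Ideal.Quotient.factor (homogIdeal_anti h)))

/-- All elements of the homogeneous ideal of a nonempty set vanish at the origin. -/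
theorem eval_zero_of_mem_homogIdeal {T : Set (ProjSpace k ι)} (hT : T.Nonempty)
    (f : MvPolynomial ι k) (hf : f ∈ homogIdeal T) :
    MvPolynomial.eval (0 : ι → k) f = 0 := by
  suffices h : homogIdeal T ≤ RingHom.ker (MvPolynomial.eval (0 : ι → k)) from h hf
  refine Ideal.span_le.mpr ?_
  rintro g ⟨⟨d, hd⟩, hg⟩
  obtain ⟨p, hp⟩ := hT
  have h0 := hg p hp (Projectivization.rep p) (Projectivization.rep_nonzero p)
    (Projectivization.mk_rep p)
  change MvPolynomial.eval (0 : ι → k) g = 0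
  rcases Nat.eq_zero_or_pos d with rfl | hpos
  · have hC := MvPolynomial.totalDegree_eq_zero_iff_eq_C.mp
      (Nat.le_zero.mp hd.totalDegree_le)
    rw [hC, MvPolynomial.eval_C] at h0 ⊢
    exact h0
  · rw [MvPolynomial.eval_zero, MvPolynomial.constantCoeff_eq]
    exact hd.coeff_eq_zero (by simpa using hpos.ne)

/-- The vertex of the cone over a nonempty `T`, i.e. the origin, as a `k`-rational point. -/
def coneVertex {T : Set (ProjSpace k ι)} (hT : T.Nonempty) :
    Spec (CommRingCat.of k) ⟶ cone T :=
  Spec.map (CommRingCat.ofHom (Ideal.Quotient.lift (homogIdeal T)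
    (MvPolynomial.eval (0 : ι → k)) (eval_zero_of_mem_homogIdeal hT)))

/-- `V × {H}` lies in `V × ℙ`. -/
theorem segreProd_singleton_subset (V : Set (ProjSpace k ι)) (H : ProjSpace k κ) :
    segreProd V {H} ⊆ segreProd V Set.univ :=
  Set.image2_subset_left (Set.subset_univ _)

theorem segreProd_nonempty {V : Set (ProjSpace k ι)} {W : Set (ProjSpace k κ)}
    (hV : V.Nonempty) (hW : W.Nonempty) : (segreProd V W).Nonempty :=
  Set.Nonempty.image2 hV hW

end

end SegreCone

namespace SegreCone

/-- On `ℙ × {[y]}` the minors `y_b z_{ia} - y_a z_{ib}` vanish. -/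
theorem minor_mem_homogIdeal {k : Type u} [Field k] {ι κ : Type} (V : Set (ProjSpace k ι))
    (H : ProjSpace k κ) (i : ι) (a b : κ) :
    (MvPolynomial.C (Projectivization.rep H b) * MvPolynomial.X (i, a) -
      MvPolynomial.C (Projectivization.rep H a) * MvPolynomial.X (i, b) :
        MvPolynomial (ι × κ) k) ∈ homogIdeal (segreProd V {H}) := by
  refine Ideal.subset_span ⟨⟨1, ?_⟩, ?_⟩
  · exact ((MvPolynomial.isHomogeneous_X k _).C_mul _).sub
      ((MvPolynomial.isHomogeneous_X k _).C_mul _)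
  · rintro _ ⟨p, -, _, rfl, rfl⟩ x hx hxp
    obtain ⟨c, rfl⟩ := (Projectivization.mk_eq_mk_iff' k _ _ _ _).mp hxp
    simp only [map_sub, map_mul, MvPolynomial.eval_C, MvPolynomial.eval_X, Pi.smul_apply,
      smul_eq_mul]
    ring

/-- Distinct points of `ℙ¹` have coordinate vectors with nonzero determinant. -/
theorem det_rep_ne_zero {k : Type u} [Field k] {H H' : ProjSpace k (Fin 2)} (hne : H ≠ H') :
    Projectivization.rep H 1 * Projectivization.rep H' 0 -
      Projectivization.rep H 0 * Projectivization.rep H' 1 ≠ 0 := by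
  intro hdet
  apply hne
  rw [← Projectivization.mk_rep H, ← Projectivization.mk_rep H']
  have hy' := Projectivization.rep_nonzero H'
  refine (Projectivization.mk_eq_mk_iff' k _ _ _ _).mpr ?_
  generalize Projectivization.rep H = y at *
  generalize Projectivization.rep H' = y' at *
  by_cases h0 : y' 0 = 0
  · have h1 : y' 1 ≠ 0 := fun h1 => hy' (by ext j; fin_cases j <;> simp [h0, h1])
    refine ⟨y 1 / y' 1, ?_⟩
    ext j
    fin_cases j
    · simp_all
    · simp [h1]
  · refine ⟨y 0 / y' 0, ?_⟩
    ext j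
    fin_cases j
    · simp [h0]
    · simp only [Fin.mk_one, Pi.smul_apply, smul_eq_mul]
      field_simp
      linear_combination -hdet

/-- The ideals of the cones over `V × {H}` and `V × {H'}` together contain all coordinates. -/
theorem X_mem_homogIdeal_sup {k : Type u} [Field k] {ι : Type} (V : Set (ProjSpace k ι))
    {H H' : ProjSpace k (Fin 2)} (hne : H ≠ H') (ij : ι × Fin 2) :
    (MvPolynomial.X ij : MvPolynomial (ι × Fin 2) k) ∈
      homogIdeal (segreProd V {H}) ⊔ homogIdeal (segreProd V {H'}) := by
  obtain ⟨i, j⟩ := ij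
  have hH := Ideal.mem_sup_left (T := homogIdeal (segreProd V {H'}))
    (minor_mem_homogIdeal V H i 0 1)
  have hH' := Ideal.mem_sup_right (S := homogIdeal (segreProd V {H}))
    (minor_mem_homogIdeal V H' i 0 1)
  refine (Ideal.unit_mul_mem_iff_mem _
    ((Ne.isUnit (det_rep_ne_zero hne)).map (MvPolynomial.C (σ := ι × Fin 2)))).mp ?_
  have key := sub_mem
    (Ideal.mul_mem_left _ (MvPolynomial.C (Projectivization.rep H' j)) hH)
    (Ideal.mul_mem_left _ (MvPolynomial.C (Projectivization.rep H j)) hH')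
  convert key using 1
  fin_cases j <;> simp only [map_sub, map_mul, Fin.zero_eta, Fin.mk_one] <;> ring

/-- The quotients of a polynomial ring by `I` and `J` have pushout `k` over the quotient by `K`,
if `I ⊔ J` is the ideal of the origin. -/
theorem isPushout_quotient_of_X_mem_sup {k : Type u} [Field k] {σ : Type}
    {I J K : Ideal (MvPolynomial σ k)} (hKI : K ≤ I) (hKJ : K ≤ J)
    (hI : ∀ f ∈ I, MvPolynomial.eval (0 : σ → k) f = 0)
    (hJ : ∀ f ∈ J, MvPolynomial.eval (0 : σ → k) f = 0)
    (hX : ∀ s, MvPolynomial.X s ∈ I ⊔ J) :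
    IsPushout (CommRingCat.ofHom (Ideal.Quotient.factor hKI))
      (CommRingCat.ofHom (Ideal.Quotient.factor hKJ))
      (CommRingCat.ofHom (Ideal.Quotient.lift I (MvPolynomial.eval (0 : σ → k)) hI))
      (CommRingCat.ofHom (Ideal.Quotient.lift J (MvPolynomial.eval (0 : σ → k)) hJ)) := by
  have hw : CommRingCat.ofHom (Ideal.Quotient.factor hKI) ≫
        CommRingCat.ofHom (Ideal.Quotient.lift I (MvPolynomial.eval (0 : σ → k)) hI) =
      CommRingCat.ofHom (Ideal.Quotient.factor hKJ) ≫
        CommRingCat.ofHom (Ideal.Quotient.lift J (MvPolynomial.eval (0 : σ → k)) hJ) := by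
    refine CommRingCat.hom_ext (Ideal.Quotient.ringHom_ext (RingHom.ext fun f => ?_))
    simp only [CommRingCat.hom_comp, CommRingCat.hom_ofHom, RingHom.comp_apply,
      Ideal.Quotient.factor_mk, Ideal.Quotient.lift_mk]
  have hcond (s : Limits.PushoutCocone (CommRingCat.ofHom (Ideal.Quotient.factor hKI))
      (CommRingCat.ofHom (Ideal.Quotient.factor hKJ))) :
      s.inl.hom.comp (Ideal.Quotient.mk I) = s.inr.hom.comp (Ideal.Quotient.mk J) :=
    RingHom.ext fun f => RingHom.congr_fun (congrArg CommRingCat.Hom.hom s.condition)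
      (Ideal.Quotient.mk K f)
  have heval (s : Limits.PushoutCocone (CommRingCat.ofHom (Ideal.Quotient.factor hKI))
      (CommRingCat.ofHom (Ideal.Quotient.factor hKJ))) :
      ((s.inl.hom.comp (Ideal.Quotient.mk I)).comp MvPolynomial.C).comp
        (MvPolynomial.eval (0 : σ → k)) = s.inl.hom.comp (Ideal.Quotient.mk I) := by
    have hker : I ⊔ J ≤ RingHom.ker (s.inl.hom.comp (Ideal.Quotient.mk I)) := by
      refine sup_le (fun f hf => ?_) (fun f hf => ?_)
      · rw [RingHom.mem_ker, RingHom.comp_apply, Ideal.Quotient.eq_zero_iff_mem.mpr hf, map_zero]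
      · rw [RingHom.mem_ker, hcond, RingHom.comp_apply, Ideal.Quotient.eq_zero_iff_mem.mpr hf,
          map_zero]
    refine MvPolynomial.ringHom_ext (fun r => ?_) (fun i => ?_)
    · rw [RingHom.comp_apply, MvPolynomial.eval_C, RingHom.comp_apply]
    · rw [RingHom.comp_apply, MvPolynomial.eval_X, Pi.zero_apply, map_zero]
      exact (RingHom.mem_ker.mp (hker (hX i))).symm
  refine ⟨⟨hw⟩, ⟨Limits.PushoutCocone.IsColimit.mk _ (fun s => CommRingCat.ofHom
    ((s.inl.hom.comp (Ideal.Quotient.mk I)).comp MvPolynomial.C)) (fun s => ?_) (fun s => ?_)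
    (fun s m hm _ => ?_)⟩⟩
  · exact CommRingCat.hom_ext (Ideal.Quotient.ringHom_ext (heval s))
  · exact CommRingCat.hom_ext (Ideal.Quotient.ringHom_ext ((heval s).trans (hcond s)))
  · refine CommRingCat.hom_ext (RingHom.ext fun r => ?_)
    change m.hom r = s.inl.hom (Ideal.Quotient.mk I (MvPolynomial.C r))
    rw [← hm]
    change m.hom r = m.hom (MvPolynomial.eval (0 : σ → k) (MvPolynomial.C r))
    rw [MvPolynomial.eval_C]

/-- The inclusion of cones maps the vertex to the vertex. -/
theorem coneVertex_comp_coneInclusion {k : Type u} [Field k] {ι : Type}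
    {S T : Set (ProjSpace k ι)} (h : S ⊆ T) (hS : S.Nonempty) :
    coneVertex hS ≫ coneInclusion h = coneVertex (hS.mono h) := by
  have hcomp : (Ideal.Quotient.lift (homogIdeal S) (MvPolynomial.eval (0 : ι → k))
      (eval_zero_of_mem_homogIdeal hS)).comp (Ideal.Quotient.factor (homogIdeal_anti h)) =
      Ideal.Quotient.lift (homogIdeal T) (MvPolynomial.eval (0 : ι → k))
        (eval_zero_of_mem_homogIdeal (hS.mono h)) := by
    refine Ideal.Quotient.ringHom_ext (RingHom.ext fun f => ?_)
    simp only [RingHom.comp_apply, Ideal.Quotient.factor_mk, Ideal.Quotient.lift_mk]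
  unfold coneVertex coneInclusion cone
  rw [← Spec.map_comp, ← CommRingCat.ofHom_comp, hcomp]

/-- The cones over `S` and `S'` meet in the reduced vertex if their ideals together contain all
coordinates. -/
theorem isPullback_coneVertex {k : Type u} [Field k] {ι : Type}
    {S S' T : Set (ProjSpace k ι)} (h : S ⊆ T) (h' : S' ⊆ T) (hS : S.Nonempty)
    (hS' : S'.Nonempty) (hX : ∀ i, MvPolynomial.X i ∈ homogIdeal S ⊔ homogIdeal S') :
    IsPullback (coneVertex hS) (coneVertex hS') (coneInclusion h) (coneInclusion h') := by
  unfold coneVertex coneInclusion cone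
  exact isPullback_SpecMap_of_isPushout _ _ _ _
    (isPushout_quotient_of_X_mem_sup (homogIdeal_anti h) (homogIdeal_anti h')
      (eval_zero_of_mem_homogIdeal hS) (eval_zero_of_mem_homogIdeal hS') hX)

end SegreCone

theorem cones_meet_in_vertex {k : Type u} [Field k] [IsAlgClosed k] (n : ℕ)
    (V : Set (SegreCone.ProjSpace k (Fin (n + 1))))
    (hV : SegreCone.IsSmoothProjectiveVariety V)
    (hdim : 0 < topologicalKrullDim V)
    (H H' : SegreCone.ProjSpace k (Fin 2)) (hne : H ≠ H') :
    IsPullback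
      (SegreCone.coneVertex
        (SegreCone.segreProd_nonempty hV.isIrreducible.nonempty (Set.singleton_nonempty H)))
      (SegreCone.coneVertex
        (SegreCone.segreProd_nonempty hV.isIrreducible.nonempty (Set.singleton_nonempty H')))
      (SegreCone.coneInclusion (SegreCone.segreProd_singleton_subset V H))
      (SegreCone.coneInclusion (SegreCone.segreProd_singleton_subset V H')) ∧
    SegreCone.coneVertex
        (SegreCone.segreProd_nonempty hV.isIrreducible.nonempty (Set.singleton_nonempty H)) ≫
      SegreCone.coneInclusion (SegreCone.segreProd_singleton_subset V H) =
    SegreCone.coneVertex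
      (SegreCone.segreProd_nonempty hV.isIrreducible.nonempty
        (Set.Nonempty.mono (Set.subset_univ {H}) (Set.singleton_nonempty H))) := by
  exact ⟨SegreCone.isPullback_coneVertex _ _ _ _ (SegreCone.X_mem_homogIdeal_sup V hne),
    SegreCone.coneVertex_comp_coneInclusion _ _⟩
end
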